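/- Let A = kQ/I be a simply connected toupie algebra with m = dim_k e_0 A e_∞ = 1 and t ≥ 2 branches. Then A is tilted. -/

import Mathlib

/-!
Formalization preamble for "Toupie algebras".

We realize the bound quiver algebra `A = kQ/I` of a toupie quiver `Q` concretely:
the path algebra `kQ` is realized, via its (faithful) left regular representation,
as the subalgebra of `Module.End k (paths → k)` generated by the operators of left
multiplication by the trivial paths `e_v` and by the arrows of `Q`.  Paths are
composed from left to right (`p * q` = "first `p`, then `q`"), as in
Assem–Simson–Skowroński, so that paths from the source `0` to the sink `∞` span
`e₀ (kQ) e∞`, and (right) `A`-modules are identified with representations of `(Q, I)`.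
Right `A`-modules are formalized as (left) modules over `Aᵐᵒᵖ`.
-/

set_option synthInstance.maxHeartbeats 400000
set_option maxHeartbeats 800000

noncomputable section
open scoped Classical
open MulOpposite

universe u

namespace Toupie

/-- Vertices of a toupie quiver with `t` branches, branch `i` having length `ℓ i ≥ 1`:
the unique source `src`, the unique sink `snk`, and for each branch `i` its interior
vertices `mid i a` (the `(a+1)`-st vertex on branch `i`, for `a : Fin (ℓ i - 1)`). -/
inductive Vtx (t : ℕ) (ℓ : Fin t → ℕ) : Type
  | src : Vtx t ℓ
  | snk : Vtx t ℓ
  | mid (i : Fin t) (a : Fin (ℓ i - 1)) : Vtx t ℓ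

/-- The `a`-th vertex on branch `i`, for `0 ≤ a ≤ ℓ i`
(`a = 0` is the source, `a = ℓ i` is the sink). -/
def vtx (t : ℕ) (ℓ : Fin t → ℕ) (i : Fin t) (a : ℕ) : Vtx t ℓ :=
  if a = 0 then .src else if h : a - 1 < ℓ i - 1 then .mid i ⟨a - 1, h⟩ else .snk

/-- The paths of a toupie quiver: trivial paths at the vertices, and for each branch
`i` and `a < b ≤ ℓ i` the path `sub i a b` along branch `i` from its `a`-th vertex to
its `b`-th vertex.  (`sub i 0 (ℓ i)` is the `i`-th branch `w i`.) -/
inductive PIdx (t : ℕ) (ℓ : Fin t → ℕ) : Type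
  | vert (v : Vtx t ℓ) : PIdx t ℓ
  | sub (i : Fin t) (a b : ℕ) (hab : a < b) (hb : b ≤ ℓ i) : PIdx t ℓ

variable (k : Type u) [Field k] (t : ℕ) (ℓ : Fin t → ℕ)

/-- The vector space with basis the set of paths of the toupie quiver. -/
abbrev PSp : Type u := PIdx t ℓ → k

variable {t ℓ}

/-- The starting vertex of a path. -/
def startIdx : PIdx t ℓ → Vtx t ℓ
  | .vert v => v
  | .sub i a _ _ _ => vtx t ℓ i a

/-- Left multiplication by the trivial path (primitive idempotent) `e_v`. -/
def Ev (v : Vtx t ℓ) : Module.End k (PSp k t ℓ) where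
  toFun f := fun p => if startIdx p = v then f p else 0
  map_add' f g := by funext p; by_cases h : startIdx p = v <;> simp [h]
  map_smul' c f := by funext p; by_cases h : startIdx p = v <;> simp [h]

/-- Strip the `j`-th arrow of branch `i` (the arrow `vtx i j ⟶ vtx i (j+1)`) from the
front of a path, if possible. -/
def strip (i : Fin t) (j : ℕ) : PIdx t ℓ → Option (PIdx t ℓ)
  | .vert _ => none
  | .sub i' a b _ hb =>
      if h : i' = i ∧ a = j then
        if hb2 : j + 1 < b then some (.sub i (j + 1) b hb2 (h.1 ▸ hb))
        else some (.vert (vtx t ℓ i b))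
      else none

/-- Left multiplication by the `j`-th arrow of branch `i`
(the arrow from `vtx i j` to `vtx i (j+1)`, for `j < ℓ i`; the zero operator for junk `j`). -/
def Ar (i : Fin t) (j : ℕ) : Module.End k (PSp k t ℓ) where
  toFun f := fun p => (strip i j p).elim 0 f
  map_add' f g := by funext p; rcases h : strip i j p with _ | q <;> simp [h]
  map_smul' c f := by funext p; rcases h : strip i j p with _ | q <;> simp [h]

variable (t ℓ)

/-- The generators of the path algebra: the trivial paths and the arrows. -/
def gens : Set (Module.End k (PSp k t ℓ)) :=
  Set.range (Ev k) ∪ {x | ∃ i j, x = Ar k i j}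

/-- The path algebra `kQ` of the toupie quiver, realized as the subalgebra of
`Module.End k (PSp k t ℓ)` generated by left multiplication by trivial paths and arrows. -/
def PathAlg : Subalgebra k (Module.End k (PSp k t ℓ)) :=
  Algebra.adjoin k (gens k t ℓ)

variable {k t ℓ}

/-- The trivial path `e_v` as an element of the path algebra. -/
def eV (v : Vtx t ℓ) : PathAlg k t ℓ :=
  ⟨Ev k v, Algebra.subset_adjoin (Or.inl ⟨v, rfl⟩)⟩

/-- The `j`-th arrow of branch `i` as an element of the path algebra. -/
def arE (i : Fin t) (j : ℕ) : PathAlg k t ℓ :=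
  ⟨Ar k i j, Algebra.subset_adjoin (Or.inr ⟨i, j, rfl⟩)⟩

/-- The path along branch `i` from its `a`-th vertex to its `b`-th vertex, as an element
of the path algebra: the product (composed from left to right) of the arrows
`a → a+1 → ⋯ → b`.  (For `b ≤ a` this is the empty product `1`.) -/
def subE (i : Fin t) (a b : ℕ) : PathAlg k t ℓ :=
  (((List.range (b - a)).map fun s => arE i (a + s)).prod)

/-- The `i`-th branch `w i` (the path from the source to the sink along branch `i`)
as an element of the path algebra. -/
def wE (i : Fin t) : PathAlg k t ℓ := subE i 0 (ℓ i)

variable {k : Type u} [Field k]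

/-- A toupie algebra `A = kQ/I`: a toupie quiver `Q` (a non-linear quiver with a unique
source, a unique sink, and all other vertices having exactly one incoming and one
outgoing arrow, i.e. `t ≥ 2` branches of lengths `ℓ i ≥ 1`), together with an admissible
ideal `I` of the path algebra `kQ`.  Since `Q` is finite and acyclic, the arrow ideal is
nilpotent, so admissibility amounts to `I ⊆ R_Q²`, i.e. every element of `I` is a linear
combination of paths of length `≥ 2`. -/
structure ToupieAlg (k : Type u) [Field k] : Type u where
  t : ℕ
  ht : 2 ≤ t
  ℓ : Fin t → ℕ
  hℓ : ∀ i, 1 ≤ ℓ i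
  I : TwoSidedIdeal (PathAlg k t ℓ)
  adm : ∀ x ∈ I, x ∈ Submodule.span k
    {y : PathAlg k t ℓ | ∃ i a b, a + 2 ≤ b ∧ b ≤ ℓ i ∧ y = subE i a b}

variable (T : ToupieAlg k)

/-- The underlying algebra `A = kQ/I` of a toupie algebra. -/
def Alg : Type u := T.I.ringCon.Quotient

instance : Ring (Alg T) := inferInstanceAs (Ring T.I.ringCon.Quotient)

/-- The quotient map `kQ → A = kQ/I`. -/
def mkA : PathAlg k T.t T.ℓ →+* Alg T := T.I.ringCon.mk'

lemma mkA_surjective : Function.Surjective (mkA T) := Quotient.mk''_surjective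

instance : Algebra k (Alg T) :=
  RingHom.toAlgebra' ((mkA T).comp (algebraMap k (PathAlg k T.t T.ℓ)))
    (by
      intro c x
      obtain ⟨y, rfl⟩ := mkA_surjective T x
      simp only [RingHom.coe_comp, Function.comp_apply, ← map_mul]
      rw [Algebra.commutes])

/-- The idempotent `e₀` (at the source) in `A`. -/
def e0 : Alg T := mkA T (eV Vtx.src)

/-- The idempotent `e∞` (at the sink) in `A`. -/
def einf : Alg T := mkA T (eV Vtx.snk)

/-- The `k`-linear map `A → A`, `x ↦ e₀ * x * e∞`, whose range is `e₀ A e∞`. -/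
def lrMap : Alg T →ₗ[k] Alg T where
  toFun x := e0 T * x * einf T
  map_add' x y := by simp [mul_add, add_mul]
  map_smul' c x := by
    simp only [RingHom.id_apply]
    rw [mul_smul_comm, smul_mul_assoc]

/-- `m = dim_k e₀ A e∞`, the dimension of the span of the (residues of the) paths from
the source to the sink. -/
def mDim : ℕ := Module.finrank k ↥(LinearMap.range (lrMap T))

/-- The branch `w i` lies in the ideal `I`. -/
def branchInI (i : Fin T.t) : Prop := wE i ∈ T.I

/-- A minimal relation: `∑_{i ∈ J} λ i • w i ∈ I` with `|J| ≥ 2`, all `λ i ≠ 0`, and no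
nonempty proper subsum in `I`. -/
def MinRel (J : Finset (Fin T.t)) (lam : Fin T.t → k) : Prop :=
  2 ≤ J.card ∧ (∀ i ∈ J, lam i ≠ 0) ∧ (∑ i ∈ J, lam i • wE i) ∈ T.I ∧
    ∀ J' ⊂ J, J'.Nonempty → (∑ i ∈ J', lam i • wE i) ∉ T.I

/-- A toupie algebra is simply connected if any two distinct branches are involved in a
common minimal relation. -/
def SimplyConnected : Prop :=
  ∀ i j : Fin T.t, i ≠ j → ∃ J lam, MinRel T J lam ∧ i ∈ J ∧ j ∈ J

/-- A (minimal) zero-relation on branch `i`: the subpath of branch `i` from its `a`-th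
to its `b`-th vertex lies in `I`, but no proper subpath of it does. -/
def ZeroRel (i : Fin T.t) (a b : ℕ) : Prop :=
  a < b ∧ b ≤ T.ℓ i ∧ subE i a b ∈ T.I ∧
    ∀ a' b', a ≤ a' → b' ≤ b → a' < b' → (a', b') ≠ (a, b) → subE i a' b' ∉ T.I

/-- There is exactly one relation on branch `i`. -/
def ExactlyOneRel (i : Fin T.t) : Prop := ∃! p : ℕ × ℕ, ZeroRel T i p.1 p.2

/-- Branch `i` carries more than one relation. -/
def MoreThanOneRel (i : Fin T.t) : Prop :=
  ∃ p q : ℕ × ℕ, p ≠ q ∧ ZeroRel T i p.1 p.2 ∧ ZeroRel T i q.1 q.2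

/-- At most one branch of `Q` has length at least three. -/
def AtMostOneLongBranch : Prop := ∀ i j : Fin T.t, 3 ≤ T.ℓ i → 3 ≤ T.ℓ j → i = j

/-- The two-sided ideal `I` is generated by the set `S`. -/
def IsGenBy {R : Type u} [Ring R] (I : TwoSidedIdeal R) (S : Set R) : Prop :=
  S ⊆ (I : Set R) ∧ ∀ J : TwoSidedIdeal R, S ⊆ (J : Set R) → (I : Set R) ⊆ (J : Set R)

/-- A toupie algebra is canonical if (after choosing two distinguished branches `i₁, i₂`)
its ideal is generated by `{w i₁ + λ j • w i₂ - w j}` over the remaining branches `j`,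
with the `λ j` pairwise distinct and nonzero. -/
def IsCanonical : Prop :=
  ∃ (i₁ i₂ : Fin T.t) (lam : Fin T.t → k), i₁ ≠ i₂ ∧
    (∀ j, j ≠ i₁ → j ≠ i₂ → lam j ≠ 0) ∧
    (∀ j j', j ≠ i₁ → j ≠ i₂ → j' ≠ i₁ → j' ≠ i₂ → j ≠ j' → lam j ≠ lam j') ∧
    IsGenBy T.I {x | ∃ j, j ≠ i₁ ∧ j ≠ i₂ ∧ x = wE i₁ + lam j • wE i₂ - wE j}

end Toupie
namespace Toupie

/-! ### Module-theoretic notions over an arbitrary ring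

Following the paper, all modules are finite-dimensional *right* modules; a right
`A`-module is formalized as a (left) module over `Aᵐᵒᵖ`.  The definitions below are
stated for modules over an arbitrary ring `R` and are applied with `R := Aᵐᵒᵖ`. -/

variable (R : Type u) [Ring R]

/-- A module is indecomposable if it is nonzero and its only idempotent endomorphisms
are `0` and the identity. -/
def Indec (M : ModuleCat.{u} R) : Prop :=
  Nontrivial M ∧ ∀ f : M →ₗ[R] M, f.comp f = f → f = 0 ∨ f = LinearMap.id

/-- Finiteness ("finite dimensionality") of a module. -/
def FdMod (M : ModuleCat.{u} R) : Prop := Module.Finite R M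

/-- `M` has projective dimension at most one: it is the quotient of a projective module
by a projective submodule. -/
def PdLeOne (M : ModuleCat.{u} R) : Prop :=
  ∃ (P : ModuleCat.{u} R) (f : P →ₗ[R] M), Function.Surjective f ∧
    Module.Projective R P ∧ Module.Projective R ↥(LinearMap.ker f)

/-- `M` has injective dimension at most one: it embeds in an injective module with
injective cokernel. -/
def IdLeOne (M : ModuleCat.{u} R) : Prop :=
  ∃ (E : ModuleCat.{u} R) (f : M →ₗ[R] E), Function.Injective f ∧
    Module.Injective R E ∧ Module.Injective R (E ⧸ LinearMap.range f)

/-- One step of a path in `ind R`: a nonzero non-isomorphism between (finite-dimensional)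
indecomposable modules. -/
def Step (M N : ModuleCat.{u} R) : Prop :=
  Indec R M ∧ FdMod R M ∧ Indec R N ∧ FdMod R N ∧
    ∃ f : M →ₗ[R] N, f ≠ 0 ∧ ¬ Function.Bijective f

/-- A path in `ind R` from `M` to `N` (possibly trivial): a chain
`M = M₀ → M₁ → ⋯ → Mₙ = N` of nonzero non-isomorphisms between indecomposables. -/
def IndPath (M N : ModuleCat.{u} R) : Prop := Relation.ReflTransGen (Step R) M N

/-- The left part `L_R`: the indecomposable (finite-dimensional) modules `M` such that
every indecomposable `X` with a path `X ⇝ M` in `ind R` has projective dimension `≤ 1`. -/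
def InLeftPart (M : ModuleCat.{u} R) : Prop :=
  Indec R M ∧ FdMod R M ∧
    ∀ X : ModuleCat.{u} R, Indec R X → FdMod R X → IndPath R X M → PdLeOne R X

/-- The right part `R_R`: the indecomposable (finite-dimensional) modules `M` such that
every indecomposable `X` with a path `M ⇝ X` in `ind R` has injective dimension `≤ 1`. -/
def InRightPart (M : ModuleCat.{u} R) : Prop :=
  Indec R M ∧ FdMod R M ∧
    ∀ X : ModuleCat.{u} R, Indec R X → FdMod R X → IndPath R M X → IdLeOne R X

/-- Hereditary: global dimension at most one, i.e. every module has projective dimension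
at most one. -/
def Hereditary : Prop := ∀ M : ModuleCat.{u} R, PdLeOne R M

/-- Quasitilted: every indecomposable projective module lies in the left part. -/
def Quasitilted : Prop :=
  ∀ P : ModuleCat.{u} R, Indec R P → FdMod R P → Module.Projective R P → InLeftPart R P

/-- A module is directed if it lies on no cycle of nonzero non-isomorphisms between
indecomposables in `ind R`. -/
def Directed (M : ModuleCat.{u} R) : Prop := ¬ Relation.TransGen (Step R) M M

/-- Weakly shod: every indecomposable (finite-dimensional) module not lying in
`L_R ∪ R_R` is directed. -/
def WeaklyShod : Prop :=
  ∀ M : ModuleCat.{u} R, Indec R M → FdMod R M →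
    ¬ InLeftPart R M → ¬ InRightPart R M → Directed R M

/-- Laura: all but finitely many isomorphism classes of indecomposable
(finite-dimensional) modules lie in `L_R ∪ R_R`. -/
def Laura : Prop :=
  ∃ S : Set (ModuleCat.{u} R), S.Finite ∧
    ∀ M : ModuleCat.{u} R, Indec R M → FdMod R M →
      ¬ InLeftPart R M → ¬ InRightPart R M → ∃ N ∈ S, Nonempty (M ≃ₗ[R] N)

/-- There are exactly `n` isomorphism classes of modules satisfying `P`. -/
def NumClasses (P : ModuleCat.{u} R → Prop) (n : ℕ) : Prop :=
  ∃ f : Fin n → ModuleCat.{u} R, (∀ i, P (f i)) ∧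
    (∀ i j, Nonempty ((f i : Type u) ≃ₗ[R] (f j : Type u)) → i = j) ∧
    ∀ M : ModuleCat.{u} R, P M → ∃ i, Nonempty ((M : Type u) ≃ₗ[R] (f i : Type u))

/-- `M` is (isomorphic to) a direct summand of `T`. -/
def IsSummandOf (T : Type u) [AddCommGroup T] [Module R T] (M : ModuleCat.{u} R) : Prop :=
  ∃ N N' : Submodule R T, IsCompl N N' ∧ Nonempty ((M : Type u) ≃ₗ[R] N)

/-- `Ext¹_R(T, T) = 0`: every self-extension `0 → T → E → T → 0` splits. -/
def SelfExtVanish (T : Type u) [AddCommGroup T] [Module R T] : Prop :=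
  ∀ (E : Type u) [AddCommGroup E] [Module R E] (ι : T →ₗ[R] E) (π : E →ₗ[R] T),
    Function.Injective ι → Function.Surjective π → LinearMap.range ι = LinearMap.ker π →
      ∃ s : T →ₗ[R] E, π.comp s = LinearMap.id

/-- A tilting module over a hereditary algebra: a finite module with `Ext¹(T,T) = 0`
having as many pairwise non-isomorphic indecomposable direct summands as there are
simple modules. -/
def IsTiltingMod (T : Type u) [AddCommGroup T] [Module R T] : Prop :=
  Module.Finite R T ∧ SelfExtVanish R T ∧
    ∃ n : ℕ, NumClasses R (fun M => Indec R M ∧ IsSummandOf R T M) n ∧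
      NumClasses R (fun M => IsSimpleModule R M) n

variable (k : Type u) [Field k]

/-- A `k`-algebra `A` is tilted if it is the endomorphism algebra of a tilting (right)
module over a hereditary finite-dimensional `k`-algebra `H`.  (Right `H`-modules are
modules over `Hᵐᵒᵖ`; the isomorphism `A ≅ End_H T` is a `k`-linear ring isomorphism.) -/
def IsTilted (A : Type u) [Ring A] [Algebra k A] : Prop :=
  ∃ (H : Type u) (_ : Ring H) (_ : Algebra k H),
    FiniteDimensional k H ∧ Hereditary Hᵐᵒᵖ ∧
      ∃ (T : Type u) (_ : AddCommGroup T) (_ : Module Hᵐᵒᵖ T),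
        IsTiltingMod Hᵐᵒᵖ T ∧
          ∃ (_ : Module k T) (_ : SMulCommClass Hᵐᵒᵖ k T) (_ : IsScalarTower k Hᵐᵒᵖ T)
            (φ : A ≃+* Module.End Hᵐᵒᵖ T), ∀ (c : k) (x : A), φ (c • x) = c • φ x

end Toupie
namespace Toupie

variable {k : Type u} [Field k] (T : ToupieAlg k)

/-! ### Right `A`-modules as representations of `(Q, I)`

For a right `A`-module `M` (a module over `Aᵐᵒᵖ`) and a vertex `v`, the space of the
corresponding representation at `v` is `M_v = M • e_v`. -/

/-- The action of the idempotent `e_v ∈ A` on a right `A`-module (= `Aᵐᵒᵖ`-module). -/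
def actV (v : Vtx T.t T.ℓ) : (Alg T)ᵐᵒᵖ := op (mkA T (eV v))

/-- The space `M_v = M • e_v` of the representation `M` at the vertex `v` is zero. -/
def VanishAt (M : ModuleCat.{u} (Alg T)ᵐᵒᵖ) (v : Vtx T.t T.ℓ) : Prop :=
  ∀ m : M, actV T v • m = 0

/-- Every simple summand of `top M = M / rad M` is one of the simple modules `S_v`,
`v ∈ vs`: for every maximal submodule `N` the simple quotient `M/N` is supported at some
vertex of `vs` (for an admissible quotient of a path algebra, the simple module `S_v` is
the unique simple on which `e_v` acts nontrivially). -/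
def TopIn (M : ModuleCat.{u} (Alg T)ᵐᵒᵖ) (vs : Set (Vtx T.t T.ℓ)) : Prop :=
  ∀ N : Submodule (Alg T)ᵐᵒᵖ M, IsCoatom N → ∃ v ∈ vs, ∃ m : M, actV T v • m ∉ N

/-- Every simple summand of the socle of `M` is one of the simple modules `S_v`,
`v ∈ vs`: every simple submodule `N ≤ M` is supported at some vertex of `vs`. -/
def SocIn (M : ModuleCat.{u} (Alg T)ᵐᵒᵖ) (vs : Set (Vtx T.t T.ℓ)) : Prop :=
  ∀ N : Submodule (Alg T)ᵐᵒᵖ M, IsAtom N → ∃ v ∈ vs, ∃ m ∈ N, actV T v • m ≠ 0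

/-- The module `D x y` (for two positions `0 ≤ x, y ≤ ℓ i₀` on the unique branch `i₀`
lying in `I`, and an auxiliary branch `i₂ ≠ i₀`): the right `A`-module with generators
`g = e₀` (at the source) and `h = e_y` (at the `y`-th vertex of branch `i₀`), subject to
the relations `g ⬝ (subpath of w i₀ from 0 to x+1) = 0` and
`g ⬝ w i₂ = h ⬝ (subpath of w i₀ from y to ℓ i₀)`.  It is presented as the quotient of
the right regular module `A ⊕ A` by the right submodule generated by
`(1 - e₀, 0)`, `(0, 1 - e_y)`, `(subE i₀ 0 (min (x+1) (ℓ i₀)), 0)` and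
`(w i₂, - subE i₀ y (ℓ i₀))`. -/
abbrev Dmod (i₀ i₂ : Fin T.t) (x y : ℕ) : Type u :=
  (Alg T × Alg T) ⧸ Submodule.span (Alg T)ᵐᵒᵖ
    ({((mkA T (1 - eV Vtx.src) : Alg T), (0 : Alg T)),
      ((0 : Alg T), (mkA T (1 - eV (vtx T.t T.ℓ i₀ y)) : Alg T)),
      ((mkA T (subE i₀ 0 (min (x + 1) (T.ℓ i₀))) : Alg T), (0 : Alg T)),
      ((mkA T (wE i₂) : Alg T), (- mkA T (subE i₀ y (T.ℓ i₀)) : Alg T))} :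
        Set (Alg T × Alg T))

end Toupie

namespace Toupie

/-! ### The incidence algebra of a finite rooted tree -/

section RootedTree

variable (k : Type u) [Field k] (V : Type) [Fintype V] [PartialOrder V]

/-- The incidence algebra of a finite poset, as a subalgebra of the matrix algebra. -/
def incAlg : Subalgebra k (Matrix V V k) where
  carrier := {M | ∀ u v, ¬ u ≤ v → M u v = 0}
  mul_mem' {M N} hM hN u v huv := by
    rw [Matrix.mul_apply]
    refine Finset.sum_eq_zero fun w _ => ?_
    by_cases h : u ≤ w
    · rw [hN w v fun h' => huv (h.trans h'), mul_zero]
    · rw [hM u w h, zero_mul]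
  add_mem' {M N} hM hN u v huv := by simp [hM u v huv, hN u v huv]
  algebraMap_mem' c u v huv := by
    rw [Matrix.algebraMap_matrix_apply, if_neg]
    rintro rfl
    exact huv le_rfl

/-- The opposite of the incidence algebra: its left modules are the right modules over the
incidence algebra. -/
def IncOp : Type u := (incAlg k V)ᵐᵒᵖ

instance : Ring (IncOp k V) := inferInstanceAs (Ring (incAlg k V)ᵐᵒᵖ)

instance : Algebra k (IncOp k V) := inferInstanceAs (Algebra k (incAlg k V)ᵐᵒᵖ)

variable {k V}

/-- The `(u, v)` matrix coefficient. -/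
def coef (u v : V) : IncOp k V →ₗ[k] k where
  toFun r := (unop r).1 u v
  map_add' _ _ := rfl
  map_smul' _ _ := rfl

lemma IncOp.ext {r s : IncOp k V} (h : ∀ u v, coef u v r = coef u v s) : r = s := by
  apply unop_injective
  apply Subtype.ext
  funext u v
  exact h u v

lemma coef_of_not_le {u v : V} (h : ¬ u ≤ v) (r : IncOp k V) : coef u v r = 0 :=
  (unop r).2 u v h

lemma coef_mul (u w : V) (r s : IncOp k V) :
    coef u w (r * s) = ∑ v, coef u v s * coef v w r := rfl

lemma coef_one (u v : V) : coef u v (1 : IncOp k V) = if u = v then 1 else 0 :=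
  Matrix.one_apply

lemma coef_mul_self (v : V) (r s : IncOp k V) :
    coef v v (r * s) = coef v v s * coef v v r := by
  rw [coef_mul, Finset.sum_eq_single v]
  · intro w _ hw
    by_cases h : v ≤ w
    · rw [coef_of_not_le (u := w) fun h' => hw (le_antisymm h' h), mul_zero]
    · rw [coef_of_not_le h, zero_mul]
  · simp

variable (k)

lemma single_mem_incAlg {u v : V} (h : u ≤ v) : Matrix.single u v 1 ∈ incAlg k V := by
  intro a b hab
  refine Matrix.single_apply_of_ne _ _ _ _ _ ?_
  rintro ⟨rfl, rfl⟩
  exact hab h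

/-- The matrix unit at `(u, v)` if `u ≤ v`, and zero otherwise. -/
def matUnit (u v : V) : IncOp k V :=
  if h : u ≤ v then op ⟨Matrix.single u v 1, single_mem_incAlg k h⟩ else 0

variable {k}

lemma coef_matUnit {u v : V} (h : u ≤ v) (a b : V) :
    coef a b (matUnit k u v) = if u = a ∧ v = b then 1 else 0 := by
  have : matUnit k u v = op ⟨Matrix.single u v 1, single_mem_incAlg k h⟩ := dif_pos h
  rw [this]
  exact Matrix.single_apply ..

lemma matUnit_of_not_le {u v : V} (h : ¬ u ≤ v) : matUnit k u v = 0 := dif_neg h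

lemma eq_sum_matUnit (r : IncOp k V) : r = ∑ u, ∑ v, coef u v r • matUnit k u v := by
  refine IncOp.ext fun a b => ?_
  simp only [map_sum, map_smul, smul_eq_mul]
  rw [Finset.sum_eq_single a, Finset.sum_eq_single b]
  · by_cases h : a ≤ b
    · simp [coef_matUnit h]
    · simp [coef_of_not_le h]
  · intro v _ hv
    by_cases h : a ≤ v
    · simp [coef_matUnit h, hv]
    · simp [matUnit_of_not_le h]
  · simp
  · intro u _ hu
    refine Finset.sum_eq_zero fun v _ => ?_
    by_cases h : u ≤ v
    · simp [coef_matUnit h, hu]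
    · simp [matUnit_of_not_le h]
  · simp

lemma coef_mul_matUnit {u v : V} (h : u ≤ v) (r : IncOp k V) (a b : V) :
    coef a b (r * matUnit k u v) = if u = a then coef v b r else 0 := by
  rw [coef_mul, Finset.sum_eq_single v]
  · rw [coef_matUnit h]
    by_cases hu : u = a <;> simp [hu]
  · intro w _ hw
    simp [coef_matUnit h, hw.symm]
  · simp

lemma coef_matUnit_mul {u v : V} (h : u ≤ v) (r : IncOp k V) (a b : V) :
    coef a b (matUnit k u v * r) = if v = b then coef a u r else 0 := by
  rw [coef_mul, Finset.sum_eq_single u]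
  · rw [coef_matUnit h]
    by_cases hu : v = b <;> simp [hu]
  · intro w _ hw
    simp [coef_matUnit h, hw.symm]
  · simp

lemma matUnit_mul_matUnit {u v w : V} (h : u ≤ v) (h' : v ≤ w) :
    matUnit k v w * matUnit k u v = matUnit k u w := by
  refine IncOp.ext fun a b => ?_
  rw [coef_mul_matUnit h, coef_matUnit h', coef_matUnit (h.trans h')]
  by_cases hu : u = a <;> simp [hu]

lemma matUnit_mul_matUnit_of_ne {u v v' w : V} (h : v ≠ v') :
    matUnit k v' w * matUnit k u v = 0 := by
  by_cases h1 : u ≤ v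
  · by_cases h2 : v' ≤ w
    · refine IncOp.ext fun a b => ?_
      rw [coef_mul_matUnit h1, coef_matUnit h2]
      simp [h.symm]
    · rw [matUnit_of_not_le h2, zero_mul]
  · rw [matUnit_of_not_le h1, mul_zero]

lemma sum_matUnit_self : ∑ v, matUnit k v v = (1 : IncOp k V) := by
  refine IncOp.ext fun a b => ?_
  rw [map_sum, coef_one, Finset.sum_eq_single a]
  · simp [coef_matUnit]
  · intro v _ hv
    simp [coef_matUnit, hv]
  · simp

lemma mul_matUnit_self (r : IncOp k V) (v : V) :
    r * matUnit k v v = ∑ w, coef v w r • matUnit k v w := by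
  refine IncOp.ext fun a b => ?_
  rw [coef_mul_matUnit le_rfl, map_sum]
  simp only [map_smul, smul_eq_mul]
  rw [Finset.sum_eq_single b]
  · by_cases h : v ≤ b
    · simp [coef_matUnit h]
    · simp [coef_of_not_le h]
  · intro w _ hw
    by_cases h : v ≤ w
    · simp [coef_matUnit h, hw]
    · simp [matUnit_of_not_le h]
  · simp

/-! #### Modules on which the structure maps are injective are projective -/

section Projective

variable {K : Type u} [AddCommGroup K] [Module k K]
  [Module (IncOp k V) K] [IsScalarTower k (IncOp k V) K]

lemma exists_retraction {u v : V} (huv : u ≤ v)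
    (h : ∀ m : K, matUnit k u v • m = 0 → matUnit k u u • m = 0) :
    ∃ ρ : K →ₗ[k] K, ∀ m : K, ρ (matUnit k u v • m) = matUnit k u u • m := by
  let β : K →ₗ[k] K := Algebra.lsmul k k K (matUnit k u v)
  let ε : K →ₗ[k] K := Algebra.lsmul k k K (matUnit k u u)
  obtain ⟨g, hg⟩ := (β.comp (LinearMap.range ε).subtype).exists_leftInverse_of_injective (by
    rw [LinearMap.ker_eq_bot']
    rintro ⟨_, m, rfl⟩ hm
    apply Subtype.ext
    apply h m
    have : matUnit k u v • matUnit k u u • m = 0 := hm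
    rwa [← mul_smul, matUnit_mul_matUnit le_rfl huv] at this)
  refine ⟨(LinearMap.range ε).subtype.comp g, fun m => ?_⟩
  have := congrArg Subtype.val (LinearMap.congr_fun hg ⟨ε m, m, rfl⟩)
  have h2 : β (ε m) = matUnit k u v • m := by
    change matUnit k u v • matUnit k u u • m = _
    rw [← mul_smul, matUnit_mul_matUnit le_rfl huv]
  simp only [LinearMap.comp_apply, Submodule.subtype_apply, h2] at this
  exact this

variable [OrderBot V] [PredOrder V]

lemma exists_compatible_sections {F : Type u} [AddCommGroup F] [Module k F]
    [Module (IncOp k V) F] [IsScalarTower k (IncOp k V) F]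
    (h : ∀ (u v : V) (m : K), u ≤ v → matUnit k u v • m = 0 → matUnit k u u • m = 0)
    (g : F →ₗ[IncOp k V] K) (hg : Function.Surjective g) :
    ∃ s : V → K →ₗ[k] F, (∀ v m, matUnit k v v • s v m = s v m) ∧
      (∀ v m, s v (matUnit k v v • m) = s v m) ∧
      (∀ v m, g (s v m) = matUnit k v v • m) ∧
      ∀ v m, v ≠ ⊥ → s v (matUnit k (Order.pred v) v • m) =
        matUnit k (Order.pred v) v • s (Order.pred v) m := by
  obtain ⟨σ, hσ⟩ := (g.restrictScalars k).exists_rightInverse_of_surjective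
    (LinearMap.range_eq_top.2 hg)
  have hσ' : ∀ m, g (σ m) = m := fun m => LinearMap.congr_fun hσ m
  choose ρ hρ using fun v : V => exists_retraction (Order.pred_le v)
    (fun m => h _ v m (Order.pred_le v))
  let L (M : Type u) [AddCommGroup M] [Module k M] [Module (IncOp k V) M]
    [IsScalarTower k (IncOp k V) M] (u v : V) : M →ₗ[k] M := Algebra.lsmul k k M (matUnit k u v)
  let step (v : V) (f : K →ₗ[k] F) : K →ₗ[k] F :=
    L F (Order.pred v) v ∘ₗ f ∘ₗ ρ v ∘ₗ L K v v +
      L F v v ∘ₗ σ ∘ₗ (L K v v - L K (Order.pred v) v ∘ₗ ρ v ∘ₗ L K v v)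
  let s : V → K →ₗ[k] F := IsWellFounded.fix (· < ·) fun v ih =>
    if hv : v = ⊥ then L F v v ∘ₗ σ ∘ₗ L K v v
    else step v (ih (Order.pred v) (Order.pred_lt_of_not_isMin (by simpa using hv)))
  have hs (v : V) : s v = if v = ⊥ then L F v v ∘ₗ σ ∘ₗ L K v v
      else step v (s (Order.pred v)) := by
    simp only [s]
    rw [IsWellFounded.fix_eq]
    split_ifs <;> rfl
  have hbot (m : K) : s ⊥ m =
      (matUnit k ⊥ ⊥ : IncOp k V) • σ ((matUnit k ⊥ ⊥ : IncOp k V) • m) := by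
    rw [hs, if_pos rfl]; rfl
  have hstep (v : V) (hv : v ≠ ⊥) (m : K) : s v m =
      matUnit k (Order.pred v) v • s (Order.pred v) (ρ v (matUnit k v v • m)) +
      matUnit k v v • σ (matUnit k v v • m -
        matUnit k (Order.pred v) v • ρ v (matUnit k v v • m)) := by
    rw [hs, if_neg hv]; rfl
  have idem (v : V) (M : Type u) [AddCommGroup M] [Module (IncOp k V) M] (m : M) :
      matUnit k v v • matUnit k v v • m = matUnit k v v • m := by
    rw [← mul_smul, matUnit_mul_matUnit le_rfl le_rfl]
  have absorb (v : V) (M : Type u) [AddCommGroup M] [Module (IncOp k V) M] (m : M) :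
      matUnit k v v • matUnit k (Order.pred v) v • m = matUnit k (Order.pred v) v • m := by
    rw [← mul_smul, matUnit_mul_matUnit (Order.pred_le v) le_rfl]
  have absorb' (v : V) (M : Type u) [AddCommGroup M] [Module (IncOp k V) M] (m : M) :
      matUnit k (Order.pred v) v • matUnit k (Order.pred v) (Order.pred v) • m =
        matUnit k (Order.pred v) v • m := by
    rw [← mul_smul, matUnit_mul_matUnit le_rfl (Order.pred_le v)]
  have h2 (v : V) (m : K) : s v (matUnit k v v • m) = s v m := by
    by_cases hv : v = ⊥
    · subst hv
      rw [hbot, hbot, idem]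
    · rw [hstep v hv, hstep v hv, idem]
  refine ⟨s, ?_, h2, ?_, ?_⟩
  · intro v m
    by_cases hv : v = ⊥
    · subst hv
      rw [hbot, idem]
    · rw [hstep v hv, smul_add, idem, absorb]
  · intro v
    induction v using WellFoundedLT.induction with
    | _ v ih =>
      intro m
      by_cases hv : v = ⊥
      · subst hv
        rw [hbot, g.map_smul, hσ', idem]
      · rw [hstep v hv, map_add, g.map_smul, g.map_smul, hσ',
          ih _ (Order.pred_lt_of_not_isMin (by simpa using hv)), smul_sub, idem, absorb, absorb']
        abel
  · intro v m hv
    rw [hstep v hv, absorb, hρ, h2, absorb', sub_self, map_zero, smul_zero, add_zero]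

lemma projective_of_injective_structure_maps
    (h : ∀ (u v : V) (m : K), u ≤ v → matUnit k u v • m = 0 → matUnit k u u • m = 0) :
    Module.Projective (IncOp k V) K := by
  refine Module.Projective.of_lifting_property'' fun g hg => ?_
  obtain ⟨s, h1, h2, h3, h4⟩ := exists_compatible_sections (F := K →₀ IncOp k V) h g hg
  have h5 (u v : V) (huv : u ≤ v) (m : K) :
      s v (matUnit k u v • m) = matUnit k u v • s u m := by
    induction v using WellFoundedLT.induction with
    | _ v ih =>
      rcases eq_or_lt_of_le huv with rfl | hlt
      · rw [h1, h2]
      · have hv : v ≠ ⊥ := (bot_le.trans_lt hlt).ne'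
        have hu := Order.le_pred_of_lt hlt
        rw [← matUnit_mul_matUnit hu (Order.pred_le v), mul_smul, mul_smul, h4 v _ hv,
          ih _ (Order.pred_lt_of_not_isMin (by simpa using hv)) hu]
  have h6 (u v w : V) (m : K) (hw : w ≠ v) : s w (matUnit k u v • m) = 0 := by
    rw [← h2, ← mul_smul, matUnit_mul_matUnit_of_ne hw.symm, zero_smul, map_zero]
  have h7 (u v w : V) (m : K) (hw : w ≠ u) : matUnit k u v • s w m = 0 := by
    rw [← h1, ← mul_smul, matUnit_mul_matUnit_of_ne hw, zero_smul]
  let S : K →ₗ[k] K →₀ IncOp k V := ∑ v, s v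
  have hS (m : K) : S m = ∑ v, s v m := by simp [S]
  have hlin (r : IncOp k V) (m : K) : S (r • m) = r • S m := by
    conv_lhs => rw [eq_sum_matUnit r]
    conv_rhs => rw [eq_sum_matUnit r]
    simp only [Finset.sum_smul, map_sum, smul_assoc, map_smul]
    refine Finset.sum_congr rfl fun u _ => Finset.sum_congr rfl fun v _ => ?_
    congr 1
    by_cases huv : u ≤ v
    · rw [hS, hS, Finset.smul_sum, Finset.sum_eq_single v, Finset.sum_eq_single u, h5 u v huv]
      · exact fun w _ hw => h7 u v w m hw
      · simp
      · exact fun w _ hw => h6 u v w m hw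
      · simp
    · simp [matUnit_of_not_le huv]
  refine ⟨{ S with map_smul' := hlin }, LinearMap.ext fun m => ?_⟩
  change g (S m) = m
  simp only [hS, map_sum, h3]
  rw [← Finset.sum_smul, sum_matUnit_self, one_smul]

end Projective

/-- The scalar action on a module over an algebra. -/
abbrev scalarModule (R : Type u) [Ring R] [Algebra k R] (M : Type u) [AddCommGroup M]
    [Module R M] : Module k M :=
  Module.compHom M (algebraMap k R)

lemma scalarModule_isScalarTower (R : Type u) [Ring R] [Algebra k R] (M : Type u)
    [AddCommGroup M] [Module R M] :
    letI := scalarModule (k := k) R M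
    IsScalarTower k R M := by
  let := scalarModule (k := k) R M
  refine ⟨fun c r m => ?_⟩
  rw [Algebra.smul_def, mul_smul]
  rfl

lemma projective_submodule [OrderBot V] [PredOrder V] {ι : Type u}
    (N : Submodule (IncOp k V) (ι →₀ IncOp k V)) : Module.Projective (IncOp k V) N := by
  refine projective_of_injective_structure_maps (k := k) (V := V) (K := N) ?_
  rintro u v ⟨f, hf⟩ huv h0
  apply Subtype.ext
  have h1 : matUnit k u v • f = 0 := congrArg Subtype.val h0
  change matUnit k u u • f = 0
  ext m : 1
  have h2 : matUnit k u v * f m = 0 := DFunLike.congr_fun h1 m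
  change matUnit k u u * f m = 0
  refine IncOp.ext fun a b => ?_
  have h3 := congrArg (coef a v) h2
  rw [coef_matUnit_mul huv, if_pos rfl, map_zero] at h3
  rw [coef_matUnit_mul le_rfl, h3]
  simp

variable (k V) in
lemma hereditary_incOp [OrderBot V] [PredOrder V] : Hereditary (IncOp k V) := by
  intro M
  refine ⟨ModuleCat.of _ (M →₀ IncOp k V), Finsupp.linearCombination (IncOp k V) id,
    Finsupp.linearCombination_id_surjective _ _, ?_, projective_submodule _⟩
  change Module.Projective (IncOp k V) (M →₀ IncOp k V)
  infer_instance

end RootedTree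

end Toupie

namespace Toupie

/-! ### The simple modules -/

section Simples

variable {k : Type u} [Field k] {V : Type} [Fintype V] [PartialOrder V]

/-- The maximal left ideal of elements whose coefficient at `(v, v)` vanishes. -/
def vertexIdeal (v : V) : Submodule (IncOp k V) (IncOp k V) where
  carrier := {r | coef v v r = 0}
  add_mem' {r s} hr hs := by
    change coef v v (r + s) = 0
    rw [map_add, show coef v v r = 0 from hr, show coef v v s = 0 from hs, add_zero]
  zero_mem' := map_zero _
  smul_mem' r s hs := by
    change coef v v (r * s) = 0
    rw [coef_mul_self, show coef v v s = 0 from hs, zero_mul]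

lemma mem_vertexIdeal {v : V} {r : IncOp k V} : r ∈ vertexIdeal v ↔ coef v v r = 0 := Iff.rfl

lemma isCoatom_vertexIdeal (v : V) : IsCoatom (vertexIdeal (k := k) v) := by
  refine ⟨fun h => ?_, fun N hN => ?_⟩
  · have : (1 : IncOp k V) ∈ vertexIdeal v := h ▸ Submodule.mem_top
    rw [mem_vertexIdeal, coef_one, if_pos rfl] at this
    exact one_ne_zero this
  · obtain ⟨r, hrN, hr⟩ := SetLike.exists_of_lt hN
    rw [mem_vertexIdeal] at hr
    have h1 : (coef v v r)⁻¹ • r ∈ N := N.smul_of_tower_mem _ hrN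
    have h2 : 1 - (coef v v r)⁻¹ • r ∈ N := hN.le (by
      rw [mem_vertexIdeal, map_sub, map_smul, coef_one, if_pos rfl, smul_eq_mul,
        inv_mul_cancel₀ hr, sub_self])
    have h3 := N.add_mem h2 h1
    rw [sub_add_cancel] at h3
    exact Submodule.eq_top_iff'.2 fun x => by simpa using N.smul_mem x h3

lemma eq_of_quotient_vertexIdeal_equiv {v w : V}
    (e : (IncOp k V ⧸ vertexIdeal (k := k) v) ≃ₗ[IncOp k V]
      (IncOp k V ⧸ vertexIdeal (k := k) w)) : v = w := by
  by_contra hne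
  have key (n : IncOp k V ⧸ vertexIdeal (k := k) w) : matUnit k v v • n = 0 := by
    obtain ⟨r, rfl⟩ := Submodule.Quotient.mk_surjective _ n
    rw [← Submodule.Quotient.mk_smul, Submodule.Quotient.mk_eq_zero, mem_vertexIdeal, smul_eq_mul,
      coef_mul_self, coef_matUnit le_rfl, if_neg (by simp [hne]), mul_zero]
  have h1 := key (e (Submodule.Quotient.mk 1))
  rw [← map_smul, e.map_eq_zero_iff, ← Submodule.Quotient.mk_smul, Submodule.Quotient.mk_eq_zero,
    mem_vertexIdeal, smul_eq_mul, mul_one, coef_matUnit le_rfl, if_pos ⟨rfl, rfl⟩] at h1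
  exact one_ne_zero h1

lemma exists_equiv_quotient_vertexIdeal (M : Type u) [AddCommGroup M] [Module (IncOp k V) M]
    [IsSimpleModule (IncOp k V) M] :
    ∃ v : V, Nonempty (M ≃ₗ[IncOp k V] (IncOp k V ⧸ vertexIdeal (k := k) v)) := by
  let := scalarModule (k := k) (IncOp k V) M
  have := scalarModule_isScalarTower (k := k) (IncOp k V) M
  have : Nontrivial M := IsSimpleModule.nontrivial (IncOp k V) M
  obtain ⟨m, hm⟩ := exists_ne (0 : M)
  let s : Set V := {v | ∃ m : M, matUnit k v v • m ≠ 0}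
  have hs : s.Nonempty := by
    by_contra h
    apply hm
    rw [← one_smul (IncOp k V) m, ← sum_matUnit_self, Finset.sum_smul]
    refine Finset.sum_eq_zero fun v _ => ?_
    by_contra hv
    exact h ⟨v, m, hv⟩
  obtain ⟨v, hv, hmax⟩ := s.toFinite.exists_maximal hs
  obtain ⟨m, hm⟩ := hv
  set n := matUnit k v v • m with hn
  have hact (r : IncOp k V) : r • n = coef v v r • n := by
    rw [hn, ← mul_smul, mul_matUnit_self, Finset.sum_smul, Finset.sum_eq_single v,
      smul_assoc]
    · intro w _ hw
      by_cases hvw : v ≤ w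
      · have h0 : matUnit k v w • m = 0 := by
          by_contra hne
          refine hw (le_antisymm (hmax ⟨matUnit k v w • m, ?_⟩ hvw) hvw)
          rwa [← mul_smul, matUnit_mul_matUnit hvw le_rfl]
        rw [smul_assoc, h0, smul_zero]
      · rw [coef_of_not_le hvw, zero_smul, zero_smul]
    · simp
  have hsurj : Function.Surjective (LinearMap.toSpanSingleton (IncOp k V) M n) :=
    IsSimpleModule.toSpanSingleton_surjective (IncOp k V) hm
  have hker : LinearMap.ker (LinearMap.toSpanSingleton (IncOp k V) M n) = vertexIdeal v := by
    ext r
    rw [LinearMap.mem_ker, LinearMap.toSpanSingleton_apply, hact, mem_vertexIdeal, smul_eq_zero,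
      or_iff_left hm]
  exact ⟨v, ⟨((Submodule.quotEquivOfEq _ _ hker.symm).trans
    (LinearMap.quotKerEquivOfSurjective _ hsurj)).symm⟩⟩

variable (k V) in
lemma numClasses_simple :
    NumClasses (IncOp k V) (fun M => IsSimpleModule (IncOp k V) M) (Fintype.card V) := by
  refine ⟨fun i => ModuleCat.of _ (IncOp k V ⧸ vertexIdeal (k := k) ((Fintype.equivFin V).symm i)),
    fun i => ?_, ?_, fun M hM => ?_⟩
  · exact isSimpleModule_iff_isCoatom.2 (isCoatom_vertexIdeal _)
  · rintro i j ⟨e⟩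
    exact (Fintype.equivFin V).symm.injective (eq_of_quotient_vertexIdeal_equiv e)
  · have : IsSimpleModule (IncOp k V) M := hM
    obtain ⟨v, ⟨e⟩⟩ := exists_equiv_quotient_vertexIdeal (k := k) (V := V) M
    obtain ⟨i, rfl⟩ := (Fintype.equivFin V).symm.surjective v
    exact ⟨i, ⟨e⟩⟩

end Simples

/-! ### The tilting module -/

section RotatedOrder

variable {V : Type} [PartialOrder V] [OrderBot V]

/-- The order of a rooted tree with the root moved to the top. -/
def RotLE (u v : V) : Prop := v = ⊥ ∨ u ≠ ⊥ ∧ u ≤ v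

lemma RotLE.refl (v : V) : RotLE v v := by
  by_cases h : v = ⊥
  · exact Or.inl h
  · exact Or.inr ⟨h, le_rfl⟩

lemma RotLE.trans {u v w : V} (h : RotLE u v) (h' : RotLE v w) : RotLE u w := by
  rcases h' with rfl | ⟨hv, hvw⟩
  · exact Or.inl rfl
  · rcases h with rfl | ⟨hu, huv⟩
    · exact absurd rfl hv
    · exact Or.inr ⟨hu, huv.trans hvw⟩

lemma RotLE.antisymm {u v : V} (h : RotLE u v) (h' : RotLE v u) : u = v := by
  rcases h with rfl | ⟨hu, huv⟩
  · rcases h' with rfl | ⟨hu, _⟩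
    · rfl
    · exact absurd rfl hu
  · rcases h' with rfl | ⟨_, hvu⟩
    · exact absurd rfl hu
    · exact le_antisymm huv hvu

end RotatedOrder

section Tilting

variable {k : Type u} [Field k] {V : Type} [Fintype V] [PartialOrder V] [OrderBot V]

/-- The left ideal presenting the quotient of the indecomposable projective module at the root
by the indecomposable projective submodule at `x` (by zero if `x` is the root). -/
def rootIdeal (x : V) : Submodule (IncOp k V) (IncOp k V) where
  carrier := {r | ∀ v, (x = ⊥ ∨ ¬ x ≤ v) → coef ⊥ v r = 0}
  add_mem' {r s} hr hs v hv := by rw [map_add, hr v hv, hs v hv, add_zero]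
  zero_mem' v _ := map_zero _
  smul_mem' r s hs v hv := by
    rw [smul_eq_mul, coef_mul]
    refine Finset.sum_eq_zero fun u _ => ?_
    by_cases huv : u ≤ v
    · rw [hs u (hv.imp_right fun h h' => h (h'.trans huv)), zero_mul]
    · rw [coef_of_not_le huv, mul_zero]

lemma mem_rootIdeal {x : V} {r : IncOp k V} :
    r ∈ rootIdeal x ↔ ∀ v, (x = ⊥ ∨ ¬ x ≤ v) → coef ⊥ v r = 0 := Iff.rfl

lemma rootIdeal_le {y x : V} (h : RotLE y x) : rootIdeal (k := k) x ≤ rootIdeal y := by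
  intro r hr v hv
  refine hr v ?_
  rcases h with rfl | ⟨hy, hyx⟩
  · exact Or.inl rfl
  · exact Or.inr fun h => (hv.resolve_left hy) (hyx.trans h)

lemma matUnit_mem_rootIdeal {x : V} (hx : x ≠ ⊥) : matUnit k ⊥ x ∈ rootIdeal (k := k) x := by
  intro v hv
  rw [coef_matUnit bot_le, if_neg]
  rintro ⟨-, rfl⟩
  exact (hv.resolve_left hx) le_rfl

variable (k)

/-- The quotient of the indecomposable projective module at the root by the one at `x`. -/
abbrev rootQuot (x : V) : Type u := IncOp k V ⧸ rootIdeal (k := k) x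

/-- The canonical generator. -/
def rootGen (x : V) : rootQuot k x := Submodule.Quotient.mk 1

variable {k}

/-- The coordinate of an element at the root. -/
def rootCoord (x : V) : rootQuot k x →ₗ[k] k :=
  (((rootIdeal (k := k) x).restrictScalars k).liftQ (coef ⊥ ⊥) fun r hr =>
    hr ⊥ (by
      by_cases h : x = ⊥
      · exact Or.inl h
      · exact Or.inr fun h' => h (le_bot_iff.1 h')))

lemma rootCoord_mk (x : V) (r : IncOp k V) :
    rootCoord x (Submodule.Quotient.mk r : rootQuot k x) = coef ⊥ ⊥ r := rfl

lemma rootCoord_gen (x : V) : rootCoord x (rootGen k x) = 1 := by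
  rw [rootGen, rootCoord_mk, coef_one, if_pos rfl]

lemma rootGen_ne_zero (x : V) : rootGen k x ≠ 0 := fun h => by
  have := rootCoord_gen (k := k) x
  rw [h, map_zero] at this
  exact zero_ne_one this

instance (x : V) : Nontrivial (rootQuot k x) := ⟨_, _, rootGen_ne_zero x⟩

lemma mk_eq_smul_rootGen {x : V} (r : IncOp k V) :
    (Submodule.Quotient.mk r : rootQuot k x) = r • rootGen k x := by
  rw [rootGen, ← Submodule.Quotient.mk_smul, smul_eq_mul, mul_one]

lemma matUnit_smul_rootGen (x : V) : (matUnit k ⊥ ⊥ : IncOp k V) • rootGen k x = rootGen k x := by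
  rw [← mk_eq_smul_rootGen, rootGen, Submodule.Quotient.eq]
  intro v _
  rw [map_sub, coef_matUnit le_rfl, coef_one]
  simp

lemma matUnit_self_smul {x : V} (v : V) (n : rootQuot k x) :
    ∃ c : k, matUnit k v v • n = c • matUnit k ⊥ v • rootGen k x := by
  obtain ⟨r, rfl⟩ := Submodule.Quotient.mk_surjective _ n
  refine ⟨coef ⊥ v r, ?_⟩
  rw [← mk_eq_smul_rootGen, ← Submodule.Quotient.mk_smul, ← Submodule.Quotient.mk_smul,
    Submodule.Quotient.eq]
  intro w _
  rw [map_sub, smul_eq_mul, coef_matUnit_mul le_rfl, LinearMap.map_smul (coef ⊥ w), smul_eq_mul,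
    coef_matUnit bot_le]
  by_cases h : v = w <;> simp [h]

lemma eq_rootCoord_smul {x : V} {n : rootQuot k x} (hn : (matUnit k ⊥ ⊥ : IncOp k V) • n = n) :
    n = rootCoord x n • rootGen k x := by
  obtain ⟨c, hc⟩ := matUnit_self_smul ⊥ n
  rw [hn, matUnit_smul_rootGen] at hc
  rw [hc, map_smul, rootCoord_gen, smul_eq_mul, mul_one]

lemma map_rootGen {x y : V} (f : rootQuot k x →ₗ[IncOp k V] rootQuot k y) :
    f (rootGen k x) = rootCoord y (f (rootGen k x)) • rootGen k y :=
  eq_rootCoord_smul (by rw [← map_smul, matUnit_smul_rootGen])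

lemma rootQuot_hom_ext {x : V} {M : Type u} [AddCommGroup M] [Module (IncOp k V) M]
    {f g : rootQuot k x →ₗ[IncOp k V] M} (h : f (rootGen k x) = g (rootGen k x)) : f = g := by
  refine LinearMap.ext fun n => ?_
  obtain ⟨r, rfl⟩ := Submodule.Quotient.mk_surjective _ n
  rw [mk_eq_smul_rootGen, map_smul, map_smul, h]

lemma rotLE_of_smul_rootGen {x y : V} {c : k} (hc : c ≠ 0)
    (f : rootQuot k x →ₗ[IncOp k V] rootQuot k y) (hf : f (rootGen k x) = c • rootGen k y) :
    RotLE y x := by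
  by_cases hx : x = ⊥
  · exact Or.inl hx
  · have h0 : matUnit k ⊥ x • rootGen k x = 0 := by
      rw [← mk_eq_smul_rootGen, Submodule.Quotient.mk_eq_zero]
      exact matUnit_mem_rootIdeal hx
    have h1 : matUnit k ⊥ x • f (rootGen k x) = 0 := by rw [← map_smul, h0, map_zero]
    rw [hf, smul_comm, smul_eq_zero, or_iff_right hc, ← mk_eq_smul_rootGen,
      Submodule.Quotient.mk_eq_zero, mem_rootIdeal] at h1
    have h2 := h1 x
    rw [coef_matUnit bot_le, if_pos ⟨rfl, rfl⟩] at h2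
    refine Or.inr ⟨fun hy => one_ne_zero (h2 (Or.inl hy)), ?_⟩
    by_contra hyx
    exact one_ne_zero (h2 (Or.inr hyx))

lemma indec_rootQuot (x : V) : Indec (IncOp k V) (ModuleCat.of _ (rootQuot k x)) := by
  refine ⟨inferInstanceAs (Nontrivial (rootQuot k x)),
    fun (f : rootQuot k x →ₗ[IncOp k V] rootQuot k x) hf => ?_⟩
  set c := rootCoord x (f (rootGen k x)) with hcdef
  have hc : f (rootGen k x) = c • rootGen k x := map_rootGen f
  have h1 : f (f (rootGen k x)) = f (rootGen k x) := LinearMap.congr_fun hf _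
  rw [hc, LinearMap.map_smul_of_tower, hc] at h1
  by_cases h0 : c = 0
  · left
    refine rootQuot_hom_ext ?_
    rw [hc, h0, zero_smul]; rfl
  · right
    refine rootQuot_hom_ext ?_
    rw [smul_right_injective _ h0 h1 |> hc.trans]; rfl

lemma eq_of_rootQuot_equiv {x y : V} (e : rootQuot k x ≃ₗ[IncOp k V] rootQuot k y) : x = y := by
  have key {x y : V} (e : rootQuot k x ≃ₗ[IncOp k V] rootQuot k y) : RotLE y x := by
    refine rotLE_of_smul_rootGen ?_ e.toLinearMap (map_rootGen e.toLinearMap)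
    intro h
    have := map_rootGen e.toLinearMap
    rw [h, zero_smul] at this
    exact rootGen_ne_zero x (e.map_eq_zero_iff.1 this)
  exact (key e.symm).antisymm (key e)

variable (k V)

/-- The tilting module. -/
abbrev tiltMod : Type u := ∀ x : V, rootQuot k x

variable {k V}

/-- The generator of the summand at `x`. -/
def tiltGen (x : V) : tiltMod k V := Pi.single x (rootGen k x)

lemma tiltMod_hom_ext {M : Type u} [AddCommGroup M] [Module (IncOp k V) M]
    {f g : tiltMod k V →ₗ[IncOp k V] M} (h : ∀ x, f (tiltGen x) = g (tiltGen x)) : f = g :=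
  LinearMap.pi_ext' fun x => rootQuot_hom_ext (h x)

/-- The matrix of an endomorphism of the tilting module. -/
def endMat (f : Module.End (IncOp k V) (tiltMod k V)) (y x : V) : k :=
  rootCoord y (f (tiltGen x) y)

lemma endMat_eq_proj_single (f : Module.End (IncOp k V) (tiltMod k V)) (y x : V) :
    LinearMap.proj (R := IncOp k V) (φ := fun x => rootQuot k x) y
      (f (LinearMap.single (IncOp k V) (fun x => rootQuot k x) x (rootGen k x))) =
      endMat f y x • rootGen k y :=
  map_rootGen (LinearMap.proj y ∘ₗ f ∘ₗ LinearMap.single (IncOp k V) (fun x => rootQuot k x) x)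

lemma apply_tiltGen (f : Module.End (IncOp k V) (tiltMod k V)) (x : V) :
    f (tiltGen x) = ∑ y, endMat f y x • tiltGen y := by
  funext y
  rw [Finset.sum_apply, Finset.sum_eq_single y]
  · simpa [tiltGen] using endMat_eq_proj_single f y x
  · intro z _ hz
    simp [tiltGen, hz.symm]
  · simp

lemma rotLE_of_endMat_ne_zero {f : Module.End (IncOp k V) (tiltMod k V)} {y x : V}
    (h : endMat f y x ≠ 0) : RotLE y x :=
  rotLE_of_smul_rootGen h
    (LinearMap.proj y ∘ₗ f ∘ₗ LinearMap.single (IncOp k V) (fun x => rootQuot k x) x)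
    (endMat_eq_proj_single f y x)

lemma end_ext {f g : Module.End (IncOp k V) (tiltMod k V)}
    (h : ∀ y x, endMat f y x = endMat g y x) : f = g :=
  tiltMod_hom_ext fun x => by simp only [apply_tiltGen, h]

lemma endMat_mul (f g : Module.End (IncOp k V) (tiltMod k V)) (y x : V) :
    endMat (f * g) y x = ∑ z, endMat f y z * endMat g z x := by
  change rootCoord y (f (g (tiltGen x)) y) = _
  rw [apply_tiltGen g]
  simp only [map_sum, LinearMap.map_smul_of_tower, Finset.sum_apply, Pi.smul_apply, map_smul,
    smul_eq_mul]
  exact Finset.sum_congr rfl fun z _ => mul_comm _ _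

lemma endMat_one (y x : V) :
    endMat (1 : Module.End (IncOp k V) (tiltMod k V)) y x = if y = x then 1 else 0 := by
  change rootCoord y (tiltGen x y) = _
  by_cases h : y = x
  · subst h
    simp [tiltGen, rootCoord_gen]
  · simp [tiltGen, h]

lemma endMat_add (f g : Module.End (IncOp k V) (tiltMod k V)) (y x : V) :
    endMat (f + g) y x = endMat f y x + endMat g y x := by
  simp [endMat]

lemma endMat_smul (c : k) (f : Module.End (IncOp k V) (tiltMod k V)) (y x : V) :
    endMat (c • f) y x = c * endMat f y x := by
  simp [endMat]

lemma exists_endMat {y x : V} (h : RotLE y x) :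
    ∃ f : Module.End (IncOp k V) (tiltMod k V), ∀ y' x',
      endMat f y' x' = if y' = y ∧ x' = x then 1 else 0 := by
  refine ⟨LinearMap.single (IncOp k V) (fun x => rootQuot k x) y ∘ₗ
    Submodule.factor (rootIdeal_le h) ∘ₗ LinearMap.proj x, fun y' x' => ?_⟩
  by_cases hx : x' = x
  · subst hx
    have : Submodule.factor (rootIdeal_le (k := k) h) (rootGen k x') = rootGen k y := rfl
    by_cases hy : y' = y
    · subst hy
      simp [endMat, tiltGen, this, rootCoord_gen]
    · simp [endMat, tiltGen, hy]
  · simp [endMat, tiltGen, hx, Ne.symm hx]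

/-- An idempotent endomorphism whose matrix has zero diagonal vanishes. -/
lemma eq_zero_of_idempotent {f : Module.End (IncOp k V) (tiltMod k V)} (hf : f * f = f)
    (h : ∀ x, endMat f x x = 0) : f = 0 := by
  let r (y x : V) : Prop := RotLE x y ∧ x ≠ y
  have : IsTrans V r := ⟨fun a b c hab hbc => ⟨hbc.1.trans hab.1, fun h => by
    subst h
    exact hab.2 (hab.1.antisymm hbc.1)⟩⟩
  have : Std.Irrefl r := ⟨fun a h => h.2 rfl⟩
  have wf := Finite.wellFounded_of_trans_of_irrefl r
  have key (y : V) : ∀ x, endMat f y x = 0 := by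
    induction y using wf.induction with
    | _ y ih =>
      intro x
      rw [← hf, endMat_mul]
      refine Finset.sum_eq_zero fun z _ => ?_
      by_cases hyz : y = z
      · rw [hyz, h, zero_mul]
      · by_cases h0 : endMat f y z = 0
        · rw [h0, zero_mul]
        · rw [ih z ⟨rotLE_of_endMat_ne_zero h0, hyz⟩ x, mul_zero]
  refine end_ext fun y x => ?_
  rw [key]
  simp [endMat]

lemma isSummandOf_rootQuot (x : V) :
    IsSummandOf (IncOp k V) (tiltMod k V) (ModuleCat.of _ (rootQuot k x)) := by
  refine ⟨LinearMap.range (LinearMap.single (IncOp k V) (fun x => rootQuot k x) x),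
    LinearMap.ker (LinearMap.proj (R := IncOp k V) (φ := fun x => rootQuot k x) x), ?_,
    ⟨LinearEquiv.ofInjective _ (LinearMap.ker_eq_bot.1 (LinearMap.ker_single _ _ x))⟩⟩
  refine IsCompl.of_eq ?_ ?_
  · rw [Submodule.eq_bot_iff]
    rintro _ ⟨⟨n, rfl⟩, hn⟩
    have : n = 0 := by simpa using hn
    rw [this, map_zero]
  · rw [Submodule.eq_top_iff']
    intro m
    rw [← add_sub_cancel (LinearMap.single (IncOp k V) (fun x => rootQuot k x) x (m x)) m]
    exact Submodule.add_mem_sup ⟨_, rfl⟩ (by simp)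

/-- The indecomposable summands of the tilting module. -/
lemma exists_equiv_rootQuot {M : ModuleCat.{u} (IncOp k V)} (hM : Indec (IncOp k V) M)
    (hs : IsSummandOf (IncOp k V) (tiltMod k V) M) :
    ∃ x : V, Nonempty (M ≃ₗ[IncOp k V] rootQuot k x) := by
  obtain ⟨N, N', hN, ⟨e⟩⟩ := hs
  let i : M →ₗ[IncOp k V] tiltMod k V := N.subtype ∘ₗ e.toLinearMap
  let p : tiltMod k V →ₗ[IncOp k V] M := e.symm.toLinearMap ∘ₗ N.projectionOnto N' hN
  have hpi (m : M) : p (i m) = m := by simp [p, i]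
  let q : Module.End (IncOp k V) (tiltMod k V) := i ∘ₗ p
  obtain ⟨x, hx⟩ : ∃ x, endMat q x x ≠ 0 := by
    by_contra! h
    have h0 : q = 0 := eq_zero_of_idempotent (LinearMap.ext fun t => by
      change i (p (i (p t))) = i (p t)
      rw [hpi]) h
    obtain ⟨a, b, hab⟩ := hM.1
    apply hab
    have h1 (m : M) : m = 0 := by
      rw [← hpi m, ← hpi (p (i m))]
      change p (q (i m)) = 0
      rw [h0, LinearMap.zero_apply, map_zero]
    rw [h1 a, h1 b]
  let a : M →ₗ[IncOp k V] rootQuot k x := LinearMap.proj x ∘ₗ i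
  let b : rootQuot k x →ₗ[IncOp k V] M :=
    p ∘ₗ LinearMap.single (IncOp k V) (fun x => rootQuot k x) x ∘ₗ
      ((endMat q x x)⁻¹ • LinearMap.id)
  have hab : a ∘ₗ b = LinearMap.id := by
    refine rootQuot_hom_ext ?_
    have := endMat_eq_proj_single q x x
    change (LinearMap.proj x ∘ₗ q ∘ₗ LinearMap.single (IncOp k V) (fun x => rootQuot k x) x)
      ((endMat q x x)⁻¹ • rootGen k x) = rootGen k x
    rw [LinearMap.map_smul_of_tower]
    change (endMat q x x)⁻¹ •
      LinearMap.proj (R := IncOp k V) (φ := fun x => rootQuot k x) x (q _) = _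
    rw [this, inv_smul_smul₀ hx]
  have hab' (n : rootQuot k x) : a (b n) = n := LinearMap.congr_fun hab n
  rcases hM.2 (b ∘ₗ a) (LinearMap.ext fun m => congrArg b (hab' (a m))) with h0 | h1
  · exfalso
    apply rootGen_ne_zero (k := k) x
    rw [← hab' (rootGen k x), ← hab' (rootGen k x)]
    change a ((b ∘ₗ a) (b (rootGen k x))) = 0
    rw [h0, LinearMap.zero_apply, map_zero]
  · exact ⟨x, ⟨LinearEquiv.ofLinearMap a b hab h1⟩⟩

variable (k V) in
lemma numClasses_summand : NumClasses (IncOp k V)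
    (fun M => Indec (IncOp k V) M ∧ IsSummandOf (IncOp k V) (tiltMod k V) M)
    (Fintype.card V) := by
  refine ⟨fun i => ModuleCat.of _ (rootQuot k ((Fintype.equivFin V).symm i)),
    fun i => ⟨indec_rootQuot _, isSummandOf_rootQuot _⟩, ?_, fun M hM => ?_⟩
  · rintro i j ⟨e⟩
    exact (Fintype.equivFin V).symm.injective (eq_of_rootQuot_equiv e)
  · obtain ⟨x, ⟨e⟩⟩ := exists_equiv_rootQuot hM.1 hM.2
    obtain ⟨i, rfl⟩ := (Fintype.equivFin V).symm.surjective x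
    exact ⟨i, ⟨e⟩⟩

lemma exists_root_lift (t : tiltMod k V) (v : V) :
    ∃ t' : tiltMod k V, matUnit k v v • t = matUnit k ⊥ v • t' ∧
      (matUnit k ⊥ ⊥ : IncOp k V) • t' = t' := by
  choose c hc using fun x => matUnit_self_smul v (t x)
  refine ⟨fun x => c x • rootGen k x, funext fun x => ?_, funext fun x => ?_⟩
  · rw [Pi.smul_apply, hc, Pi.smul_apply, smul_comm]
  · rw [Pi.smul_apply, smul_comm, matUnit_smul_rootGen]

/-- Elements annihilated by the ideals presenting the summands can be lifted. -/
lemma exists_lift_tiltGen {E : Type u} [AddCommGroup E] [Module (IncOp k V) E]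
    (i : tiltMod k V →ₗ[IncOp k V] E) (π : E →ₗ[IncOp k V] tiltMod k V)
    (hi : Function.Injective i) (hπ : Function.Surjective π)
    (hex : LinearMap.range i = LinearMap.ker π) (x : V) :
    ∃ e : E, π e = tiltGen x ∧ ∀ r ∈ rootIdeal (k := k) x, r • e = 0 := by
  let := scalarModule (k := k) (IncOp k V) E
  have := scalarModule_isScalarTower (k := k) (IncOp k V) E
  have hroot : (matUnit k ⊥ ⊥ : IncOp k V) • (tiltGen x : tiltMod k V) = tiltGen x := by
    rw [tiltGen, ← Pi.single_smul, matUnit_smul_rootGen]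
  obtain ⟨e₀, he₀⟩ := hπ (tiltGen x)
  set e := (matUnit k ⊥ ⊥ : IncOp k V) • e₀ with he
  have hπe : π e = tiltGen x := by rw [he, map_smul, he₀, hroot]
  have hee : (matUnit k ⊥ ⊥ : IncOp k V) • e = e := by
    rw [he, ← mul_smul, matUnit_mul_matUnit le_rfl le_rfl]
  have expand (e : E) (hee : (matUnit k ⊥ ⊥ : IncOp k V) • e = e) (r : IncOp k V) :
      r • e = ∑ w, coef ⊥ w r • matUnit k ⊥ w • e := by
    conv_lhs => rw [← hee, ← mul_smul, mul_matUnit_self, Finset.sum_smul]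
    simp only [smul_assoc]
  by_cases hx : x = ⊥
  · refine ⟨e, hπe, fun r hr => ?_⟩
    rw [expand e hee]
    exact Finset.sum_eq_zero fun w _ => by rw [hr w (Or.inl hx), zero_smul]
  · have h0 : matUnit k ⊥ x • e ∈ LinearMap.ker π := by
      rw [LinearMap.mem_ker, map_smul, hπe, tiltGen, ← Pi.single_smul, ← mk_eq_smul_rootGen,
        (Submodule.Quotient.mk_eq_zero _).2 (matUnit_mem_rootIdeal hx), Pi.single_zero]
    rw [← hex] at h0
    obtain ⟨t, ht⟩ := h0
    have hxt : matUnit k x x • t = t := hi (by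
      rw [map_smul, ht, ← mul_smul, matUnit_mul_matUnit bot_le le_rfl])
    obtain ⟨t', ht', hrt'⟩ := exists_root_lift t x
    have hee' : (matUnit k ⊥ ⊥ : IncOp k V) • (e - i t') = e - i t' := by
      rw [smul_sub, hee, ← map_smul, hrt']
    refine ⟨e - i t', ?_, fun r hr => ?_⟩
    · have : π (i t') = 0 := by
        rw [← LinearMap.mem_ker, ← hex]
        exact ⟨t', rfl⟩
      rw [map_sub, hπe, this, sub_zero]
    · rw [expand _ hee']
      refine Finset.sum_eq_zero fun w _ => ?_
      by_cases hw : x ≤ w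
      · rw [← matUnit_mul_matUnit bot_le hw, mul_smul, smul_sub, ← ht, ← map_smul, ← ht', hxt,
          sub_self, smul_zero, smul_zero]
      · rw [hr w (Or.inr hw), zero_smul]

variable (k V) in
lemma selfExtVanish_tiltMod : SelfExtVanish (IncOp k V) (tiltMod k V) := by
  intro E _ _ i π hi hπ hex
  choose e he h0 using fun x => exists_lift_tiltGen i π hi hπ hex x
  refine ⟨LinearMap.lsum (IncOp k V) (fun x => rootQuot k x) ℕ fun x =>
    (rootIdeal (k := k) x).liftQ (LinearMap.toSpanSingleton (IncOp k V) E (e x))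
      fun r hr => by simpa using h0 x r hr, tiltMod_hom_ext fun x => ?_⟩
  rw [LinearMap.comp_apply, tiltGen, LinearMap.lsum_piSingle, rootGen]
  change π ((1 : IncOp k V) • e x) = _
  rw [one_smul, he]
  rfl

variable (k V) in
lemma isTiltingMod_tiltMod : IsTiltingMod (IncOp k V) (tiltMod k V) :=
  ⟨inferInstance, selfExtVanish_tiltMod k V, Fintype.card V, numClasses_summand k V,
    numClasses_simple k V⟩

/-- An algebra with a multiplicative basis indexed by the order relation of a finite rooted tree
with the root moved to the top is tilted. -/
theorem isTilted_of_multiplicative_basis [PredOrder V] {A : Type u} [Ring A] [Algebra k A]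
    (p : V → V → A)
    (hmul : ∀ u v w, RotLE u v → RotLE v w → p u v * p v w = p u w)
    (horth : ∀ u v v' w, v ≠ v' → p u v * p v' w = 0)
    (hone : ∑ v, p v v = 1)
    (hspan : ∀ a : A, a ∈ Submodule.span k {b | ∃ u v, RotLE u v ∧ b = p u v})
    (hne : ∀ u v, RotLE u v → p u v ≠ 0) : IsTilted k A := by
  let Φ : Module.End (IncOp k V) (tiltMod k V) →ₗ[k] A :=
    { toFun := fun f => ∑ y, ∑ x, endMat f y x • p y x
      map_add' := fun f g => by
        simp only [endMat_add, add_smul, Finset.sum_add_distrib]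
      map_smul' := fun c f => by
        simp only [endMat_smul, mul_smul, Finset.smul_sum, RingHom.id_apply] }
  have hΦ (f) : Φ f = ∑ y, ∑ x, endMat f y x • p y x := rfl
  have hΦone : Φ 1 = 1 := by
    simp [hΦ, endMat_one, hone]
  have hΦmul (f g) : Φ (f * g) = Φ f * Φ g := by
    simp only [hΦ, endMat_mul, Finset.sum_smul]
    rw [Finset.sum_mul]
    refine Finset.sum_congr rfl fun y _ => ?_
    rw [Finset.sum_comm, Finset.sum_mul]
    refine Finset.sum_congr rfl fun z _ => ?_
    rw [Finset.mul_sum]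
    symm
    rw [Finset.sum_eq_single z]
    · rw [Finset.mul_sum]
      refine Finset.sum_congr rfl fun x _ => ?_
      by_cases h1 : endMat f y z = 0
      · simp [h1]
      by_cases h2 : endMat g z x = 0
      · simp [h2]
      rw [smul_mul_smul_comm, hmul _ _ _ (rotLE_of_endMat_ne_zero h1) (rotLE_of_endMat_ne_zero h2)]
    · intro z' _ hz
      rw [Finset.mul_sum]
      refine Finset.sum_eq_zero fun x _ => ?_
      rw [smul_mul_smul_comm, horth _ _ _ _ hz.symm, smul_zero]
    · simp
  have hinj : Function.Injective Φ := by
    rw [injective_iff_map_eq_zero]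
    intro f hf
    refine end_ext fun y x => ?_
    by_contra h
    have hle : RotLE y x := rotLE_of_endMat_ne_zero fun h' => h (by rw [h']; simp [endMat])
    have h1 : p y y * Φ f * p x x = endMat f y x • p y x := by
      rw [hΦ, Finset.mul_sum, Finset.sum_mul, Finset.sum_eq_single y, Finset.mul_sum,
        Finset.sum_mul, Finset.sum_eq_single x, mul_smul_comm, smul_mul_assoc,
        hmul _ _ _ (RotLE.refl y) hle, hmul _ _ _ hle (RotLE.refl x)]
      · intro z _ hz
        rw [mul_smul_comm, smul_mul_assoc, mul_assoc, horth _ _ _ _ hz, mul_zero, smul_zero]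
      · simp
      · intro z _ hz
        rw [Finset.mul_sum, Finset.sum_mul]
        refine Finset.sum_eq_zero fun z' _ => ?_
        rw [mul_smul_comm, smul_mul_assoc, horth _ _ _ _ hz.symm, zero_mul, smul_zero]
      · simp
    rw [hf, mul_zero, zero_mul] at h1
    refine h ((smul_eq_zero.1 h1.symm).resolve_right (hne _ _ hle) |>.trans ?_)
    simp [endMat]
  have hsurj : Function.Surjective Φ := by
    rw [← LinearMap.range_eq_top, Submodule.eq_top_iff']
    intro a
    refine Submodule.span_le.2 ?_ (hspan a)
    rintro _ ⟨u, v, huv, rfl⟩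
    obtain ⟨f, hf⟩ := exists_endMat (k := k) huv
    refine ⟨f, ?_⟩
    rw [hΦ, Finset.sum_eq_single u, Finset.sum_eq_single v]
    · simp [hf]
    · intro w _ hw
      simp [hf, hw]
    · simp
    · intro w _ hw
      simp [hf, hw]
    · simp
  let ψ : Module.End (IncOp k V) (tiltMod k V) ≃+* A :=
    RingEquiv.ofBijective (⟨⟨⟨Φ, hΦone⟩, hΦmul⟩, map_zero Φ, map_add Φ⟩ :
      Module.End (IncOp k V) (tiltMod k V) →+* A) ⟨hinj, hsurj⟩
  have hψ (c : k) (a : A) : ψ.symm (c • a) = c • ψ.symm a := by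
    refine ψ.injective ?_
    have : ψ (c • ψ.symm a) = c • ψ (ψ.symm a) := Φ.map_smul c (ψ.symm a)
    rw [this, RingEquiv.apply_symm_apply, RingEquiv.apply_symm_apply]
  exact ⟨incAlg k V, inferInstance, inferInstance, inferInstance, hereditary_incOp k V,
    tiltMod k V, inferInstance, inferInstanceAs (Module (IncOp k V) (tiltMod k V)),
    isTiltingMod_tiltMod k V, inferInstance,
    inferInstanceAs (SMulCommClass (IncOp k V) k (tiltMod k V)),
    inferInstanceAs (IsScalarTower k (IncOp k V) (tiltMod k V)), ψ.symm, fun c a => hψ c a⟩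

end Tilting

end Toupie

namespace Toupie

/-! ### The rooted tree on the vertices of a toupie quiver -/

section VertexOrder

variable {t : ℕ} {ℓ : Fin t → ℕ}

/-- The order of the rooted tree obtained from the quiver by moving the sink below the source. -/
def Vtx.Le : Vtx t ℓ → Vtx t ℓ → Prop
  | .snk, _ => True
  | .src, .snk => False
  | .src, _ => True
  | .mid i a, .mid j b => i = j ∧ a.val ≤ b.val
  | .mid _ _, _ => False

instance : PartialOrder (Vtx t ℓ) where
  le := Vtx.Le
  le_refl u := by cases u <;> simp [Vtx.Le]
  le_trans u v w := by
    cases u <;> cases v <;> cases w <;> simp +contextual [Vtx.Le]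
    omega
  le_antisymm u v := by
    cases u <;> cases v <;> simp +contextual [Vtx.Le]
    rintro rfl h h'
    exact heq_of_eq (Fin.ext (le_antisymm h h'))

instance : OrderBot (Vtx t ℓ) where
  bot := .snk
  bot_le _ := trivial

lemma Vtx.bot_eq : (⊥ : Vtx t ℓ) = .snk := rfl

/-- The predecessor of a vertex in the rooted tree. -/
def Vtx.predFun : Vtx t ℓ → Vtx t ℓ
  | .snk => .snk
  | .src => .snk
  | .mid i a => if a.val = 0 then .src else .mid i ⟨a.val - 1, by omega⟩

lemma Vtx.predFun_mid (i : Fin t) (a : Fin (ℓ i - 1)) :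
    Vtx.predFun (.mid i a : Vtx t ℓ) = if a.val = 0 then .src else .mid i ⟨a.val - 1, by omega⟩ :=
  rfl

instance : PredOrder (Vtx t ℓ) where
  pred := Vtx.predFun
  pred_le u := by
    change Vtx.Le _ _
    rcases u with _ | _ | ⟨i, a⟩
    · trivial
    · trivial
    · rw [Vtx.predFun_mid]
      split_ifs <;> simp [Vtx.Le]
  min_of_le_pred {u} h v _ := by
    change Vtx.Le _ _ at h
    change Vtx.Le _ _
    rcases u with _ | _ | ⟨i, a⟩
    · exact h.elim
    · trivial
    · rw [Vtx.predFun_mid] at h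
      split_ifs at h with ha
      · exact h.elim
      · exact absurd h.2 (by simp; omega)
  le_pred_of_lt {u v} h := by
    have h1 : Vtx.Le u v := h.le
    have h2 : ¬ Vtx.Le v u := not_le_of_gt h
    change Vtx.Le _ _
    rcases u with _ | _ | ⟨i, a⟩
    · rcases v with _ | _ | ⟨j, b⟩
      · exact (h2 trivial).elim
      · exact h1.elim
      · rw [Vtx.predFun_mid]
        split_ifs <;> trivial
    · trivial
    · rcases v with _ | _ | ⟨j, b⟩
      · exact h1.elim
      · exact h1.elim
      · obtain ⟨rfl, hab⟩ := h1
        have : a.val < b.val := by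
          by_contra hba
          exact h2 ⟨rfl, not_lt.1 hba⟩
        rw [Vtx.predFun_mid]
        rw [if_neg (by omega)]
        exact ⟨rfl, by simp; omega⟩

instance : Finite (Vtx t ℓ) :=
  Finite.of_surjective
    (fun x : Option (Option (Σ i : Fin t, Fin (ℓ i - 1))) =>
      x.elim Vtx.src fun y => y.elim Vtx.snk fun z => Vtx.mid z.1 z.2)
    fun v => by
      rcases v with _ | _ | ⟨i, a⟩
      · exact ⟨none, rfl⟩
      · exact ⟨some none, rfl⟩
      · exact ⟨some (some ⟨i, a⟩), rfl⟩

instance : Fintype (Vtx t ℓ) := Fintype.ofFinite _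

lemma vtx_zero (i : Fin t) : vtx t ℓ i 0 = .src := if_pos rfl

lemma vtx_mid {i : Fin t} {a : ℕ} (h0 : a ≠ 0) (h : a < ℓ i) :
    vtx t ℓ i a = .mid i ⟨a - 1, by omega⟩ := by
  rw [vtx, if_neg h0, dif_pos (by omega)]

lemma vtx_last {i : Fin t} (h : 1 ≤ ℓ i) : vtx t ℓ i (ℓ i) = .snk := by
  rw [vtx, if_neg (by omega), dif_neg (by omega)]

lemma vtx_eq_vtx {i i' : Fin t} {a a' : ℕ} (ha : a ≤ ℓ i) (ha' : a' ≤ ℓ i')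
    (h : vtx t ℓ i a = vtx t ℓ i' a') :
    (i = i' ∧ a = a') ∨ (a = 0 ∧ a' = 0) ∨ (a = ℓ i ∧ a' = ℓ i') := by
  unfold vtx at h
  split_ifs at h with h1 h2 h3 h4 h5 h6
  · exact Or.inr (Or.inl ⟨h1, h2⟩)
  · rw [Vtx.mid.injEq] at h
    obtain ⟨rfl, h⟩ := h
    have := congrArg Fin.val (eq_of_heq h)
    exact Or.inl ⟨rfl, by simp at this; omega⟩
  · exact Or.inr (Or.inr ⟨by omega, by omega⟩)

lemma exists_vtx_eq (hℓ : ∀ i, 1 ≤ ℓ i) (i₀ : Fin t) (v : Vtx t ℓ) :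
    ∃ i, ∃ a ≤ ℓ i, v = vtx t ℓ i a := by
  rcases v with _ | _ | ⟨i, a⟩
  · exact ⟨i₀, 0, Nat.zero_le _, (vtx_zero _).symm⟩
  · exact ⟨i₀, ℓ i₀, le_rfl, (vtx_last (hℓ _)).symm⟩
  · exact ⟨i, a + 1, by omega, by rw [vtx_mid (by omega) (by omega)]; simp⟩

lemma exists_vtx_of_le {i : Fin t} {b : ℕ} {u : Vtx t ℓ} (hb : b < ℓ i) (hu : u ≠ ⊥)
    (h : u ≤ vtx t ℓ i b) : ∃ a ≤ b, u = vtx t ℓ i a := by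
  change Vtx.Le _ _ at h
  rcases u with _ | _ | ⟨j, a⟩
  · exact ⟨0, Nat.zero_le _, (vtx_zero _).symm⟩
  · exact (hu rfl).elim
  · by_cases h0 : b = 0
    · subst h0
      rw [vtx_zero] at h
      exact h.elim
    · rw [vtx_mid h0 hb] at h
      obtain ⟨rfl, h⟩ := h
      have h : a.val ≤ b - 1 := h
      exact ⟨a + 1, by omega, by rw [vtx_mid (by omega) (by omega)]; simp⟩

lemma exists_chain (hℓ : ∀ i, 1 ≤ ℓ i) (i₀ : Fin t) {u v w : Vtx t ℓ} (huv : RotLE u v)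
    (hvw : RotLE v w) : ∃ i a b c, a ≤ b ∧ b ≤ c ∧ c ≤ ℓ i ∧
      u = vtx t ℓ i a ∧ v = vtx t ℓ i b ∧ w = vtx t ℓ i c := by
  have lt_of_ne {i : Fin t} {a : ℕ} (ha : a ≤ ℓ i) (h : vtx t ℓ i a ≠ ⊥) : a < ℓ i := by
    refine lt_of_le_of_ne ha ?_
    rintro rfl
    exact h (vtx_last (hℓ i))
  by_cases hv : v = ⊥
  · obtain rfl : w = ⊥ := hvw.resolve_right fun h => h.1 hv
    obtain ⟨i, a, ha, rfl⟩ := exists_vtx_eq hℓ i₀ u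
    exact ⟨i, a, ℓ i, ℓ i, ha, le_rfl, le_rfl, rfl, hv.trans (vtx_last (hℓ i)).symm,
      (vtx_last (hℓ i)).symm⟩
  have huv := huv.resolve_left hv
  by_cases hw : w = ⊥
  · obtain ⟨i, b, hb, rfl⟩ := exists_vtx_eq hℓ i₀ v
    obtain ⟨a, ha, rfl⟩ := exists_vtx_of_le (lt_of_ne hb hv) huv.1 huv.2
    exact ⟨i, a, b, ℓ i, ha, hb, le_rfl, rfl, rfl, hw.trans (vtx_last (hℓ i)).symm⟩
  · have hvw := hvw.resolve_left hw
    obtain ⟨i, c, hc, rfl⟩ := exists_vtx_eq hℓ i₀ w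
    have hc' := lt_of_ne hc hw
    obtain ⟨b, hb, rfl⟩ := exists_vtx_of_le hc' hvw.1 hvw.2
    obtain ⟨a, ha, rfl⟩ := exists_vtx_of_le (hb.trans_lt hc') huv.1 huv.2
    exact ⟨i, a, b, c, ha, hb, hc, rfl, rfl, rfl⟩

lemma rotLE_vtx (hℓ : ∀ i, 1 ≤ ℓ i) {i : Fin t} {a b : ℕ} (hab : a ≤ b) (hb : b ≤ ℓ i) :
    RotLE (vtx t ℓ i a) (vtx t ℓ i b) := by
  by_cases hbl : b = ℓ i
  · exact Or.inl (hbl ▸ vtx_last (hℓ i))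
  right
  by_cases ha0 : a = 0
  · subst ha0
    rw [vtx_zero]
    refine ⟨by simp [Vtx.bot_eq], ?_⟩
    by_cases hb0 : b = 0
    · rw [hb0, vtx_zero]
    · rw [vtx_mid hb0 (by omega)]
      trivial
  · rw [vtx_mid ha0 (by omega), vtx_mid (by omega) (by omega)]
    exact ⟨by simp [Vtx.bot_eq], rfl, by simp; omega⟩

end VertexOrder

/-! ### The path algebra -/

section PathAlgebra

variable {k : Type u} [Field k] {t : ℕ} {ℓ : Fin t → ℕ}

lemma eV_mul_eV (u v : Vtx t ℓ) : (eV u * eV v : PathAlg k t ℓ) = if u = v then eV v else 0 := by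
  refine Subtype.ext (LinearMap.ext fun f => funext fun p => ?_)
  change (if startIdx p = u then (if startIdx p = v then f p else 0) else 0) = _
  by_cases huv : u = v
  · subst huv
    rw [if_pos rfl]
    change _ = (if startIdx p = u then f p else 0)
    split_ifs <;> rfl
  · rw [if_neg huv]
    change _ = (0 : k)
    split_ifs with h1 h2
    · exact absurd (h1.symm.trans h2) huv
    · rfl
    · rfl

lemma eV_mul_self (v : Vtx t ℓ) : (eV v * eV v : PathAlg k t ℓ) = eV v := by
  rw [eV_mul_eV, if_pos rfl]

lemma sum_eV : ∑ v, (eV v : PathAlg k t ℓ) = 1 := by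
  refine Subtype.ext (LinearMap.ext fun f => funext fun p => ?_)
  rw [AddSubmonoidClass.coe_finsetSum, LinearMap.sum_apply, Finset.sum_apply]
  change ∑ v, (if startIdx p = v then f p else 0) = f p
  simp

lemma strip_eq_some {i : Fin t} {j : ℕ} {p q : PIdx t ℓ} (h : strip i j p = some q) :
    startIdx p = vtx t ℓ i j ∧ startIdx q = vtx t ℓ i (j + 1) ∧ j < ℓ i := by
  rcases p with v | ⟨i', a, b, hab, hb⟩
  · simp [strip] at h
  · simp only [strip] at h
    split_ifs at h with h1 h2
    · obtain ⟨rfl, rfl⟩ := h1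
      rw [Option.some.injEq] at h
      subst h
      exact ⟨rfl, rfl, by omega⟩
    · obtain ⟨rfl, rfl⟩ := h1
      rw [Option.some.injEq] at h
      subst h
      obtain rfl : b = a + 1 := by omega
      exact ⟨rfl, rfl, by omega⟩

lemma eV_mul_arE (i : Fin t) (j : ℕ) :
    (eV (vtx t ℓ i j) * arE i j : PathAlg k t ℓ) = arE i j := by
  refine Subtype.ext (LinearMap.ext fun f => funext fun p => ?_)
  change (if startIdx p = vtx t ℓ i j then (strip i j p).elim 0 f else 0) = (strip i j p).elim 0 f
  rcases h : strip i j p with _ | q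
  · simp
  · rw [if_pos (strip_eq_some h).1]

lemma arE_mul_eV (i : Fin t) (j : ℕ) :
    (arE i j * eV (vtx t ℓ i (j + 1)) : PathAlg k t ℓ) = arE i j := by
  refine Subtype.ext (LinearMap.ext fun f => funext fun p => ?_)
  change (strip i j p).elim 0 (fun q => if startIdx q = vtx t ℓ i (j + 1) then f q else 0) =
    (strip i j p).elim 0 f
  rcases h : strip i j p with _ | q
  · rfl
  · exact if_pos (strip_eq_some h).2.1

lemma arE_eq_zero {i : Fin t} {j : ℕ} (hj : ℓ i ≤ j) : (arE i j : PathAlg k t ℓ) = 0 := by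
  refine Subtype.ext (LinearMap.ext fun f => funext fun p => ?_)
  change (strip i j p).elim 0 f = 0
  rcases h : strip i j p with _ | q
  · rfl
  · exact absurd (strip_eq_some h).2.2 (not_lt.2 hj)

lemma subE_self (i : Fin t) (a : ℕ) : (subE i a a : PathAlg k t ℓ) = 1 := by
  simp [subE]

lemma subE_succ {i : Fin t} {a b : ℕ} (h : a ≤ b) :
    (subE i a (b + 1) : PathAlg k t ℓ) = subE i a b * arE i b := by
  rw [subE, subE, Nat.succ_sub h, List.range_succ, List.map_append, List.prod_append]
  simp [Nat.add_sub_cancel' h]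

lemma subE_mul_subE {i : Fin t} {a b c : ℕ} (hab : a ≤ b) (hbc : b ≤ c) :
    (subE i a b * subE i b c : PathAlg k t ℓ) = subE i a c := by
  induction c, hbc using Nat.le_induction with
  | base => rw [subE_self, mul_one]
  | succ c hbc ih => rw [subE_succ hbc, ← mul_assoc, ih, subE_succ (hab.trans hbc)]

/-- The path along branch `i` from its `a`-th to its `b`-th vertex, including trivial paths. -/
def pathE (i : Fin t) (a b : ℕ) : PathAlg k t ℓ := eV (vtx t ℓ i a) * subE i a b

lemma pathE_self (i : Fin t) (a : ℕ) : (pathE i a a : PathAlg k t ℓ) = eV (vtx t ℓ i a) := by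
  rw [pathE, subE_self, mul_one]

lemma pathE_succ {i : Fin t} {a b : ℕ} (h : a ≤ b) :
    (pathE i a (b + 1) : PathAlg k t ℓ) = pathE i a b * arE i b := by
  rw [pathE, pathE, subE_succ h, mul_assoc]

lemma eV_mul_pathE (i : Fin t) (a b : ℕ) :
    (eV (vtx t ℓ i a) * pathE i a b : PathAlg k t ℓ) = pathE i a b := by
  rw [pathE, ← mul_assoc, eV_mul_self]

lemma pathE_mul_eV {i : Fin t} {a b : ℕ} (h : a ≤ b) :
    (pathE i a b * eV (vtx t ℓ i b) : PathAlg k t ℓ) = pathE i a b := by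
  induction b, h using Nat.le_induction with
  | base => rw [pathE_self, eV_mul_self]
  | succ b h ih => rw [pathE_succ h, mul_assoc, arE_mul_eV]

lemma pathE_mul_pathE {i : Fin t} {a b c : ℕ} (hab : a ≤ b) (hbc : b ≤ c) :
    (pathE i a b * pathE i b c : PathAlg k t ℓ) = pathE i a c := by
  rw [pathE.eq_1 i b, ← mul_assoc, pathE_mul_eV hab, pathE, mul_assoc, subE_mul_subE hab hbc, pathE]

lemma pathE_arrow (i : Fin t) (j : ℕ) : (pathE i j (j + 1) : PathAlg k t ℓ) = arE i j := by
  rw [pathE_succ le_rfl, pathE_self, eV_mul_arE]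

lemma wE_eq_pathE {i : Fin t} (h : 1 ≤ ℓ i) : (wE i : PathAlg k t ℓ) = pathE i 0 (ℓ i) := by
  rw [wE, ← subE_mul_subE (Nat.zero_le 1) h, ← pathE_mul_pathE (Nat.zero_le 1) h, pathE_arrow,
    pathE, subE_succ le_rfl, subE_self, one_mul, ← mul_assoc, arE_mul_eV]

variable (k t ℓ) in
/-- The span of all paths. -/
def pathSpan : Submodule k (PathAlg k t ℓ) :=
  Submodule.span k {x | ∃ i a b, a ≤ b ∧ b ≤ ℓ i ∧ x = pathE i a b}

lemma pathE_mem_pathSpan {i : Fin t} {a b : ℕ} (hab : a ≤ b) (hb : b ≤ ℓ i) :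
    pathE i a b ∈ pathSpan k t ℓ :=
  Submodule.subset_span ⟨i, a, b, hab, hb, rfl⟩

lemma eV_mul_mem_pathSpan (v : Vtx t ℓ) {y : PathAlg k t ℓ} (hy : y ∈ pathSpan k t ℓ) :
    eV v * y ∈ pathSpan k t ℓ := by
  refine Submodule.span_induction ?_ ?_ (fun x y _ _ hx hy => ?_) (fun c x _ hx => ?_) hy
  · rintro _ ⟨i, a, b, hab, hb, rfl⟩
    rw [← eV_mul_pathE, ← mul_assoc, eV_mul_eV]
    split_ifs
    · rw [eV_mul_pathE]
      exact pathE_mem_pathSpan hab hb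
    · rw [zero_mul]
      exact zero_mem _
  · rw [mul_zero]
    exact zero_mem _
  · rw [mul_add]
    exact add_mem hx hy
  · rw [mul_smul_comm]
    exact Submodule.smul_mem _ _ hx

lemma arE_mul_mem_pathSpan (i : Fin t) (j : ℕ) {y : PathAlg k t ℓ}
    (hy : y ∈ pathSpan k t ℓ) : arE i j * y ∈ pathSpan k t ℓ := by
  by_cases hj : ℓ i ≤ j
  · rw [arE_eq_zero hj, zero_mul]
    exact zero_mem _
  push Not at hj
  refine Submodule.span_induction ?_ ?_ (fun x y _ _ hx hy => ?_) (fun c x _ hx => ?_) hy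
  · rintro _ ⟨i', a, b, hab, hb, rfl⟩
    by_cases h : vtx t ℓ i (j + 1) = vtx t ℓ i' a
    · rcases vtx_eq_vtx hj (hab.trans hb) h with ⟨rfl, rfl⟩ | ⟨h1, -⟩ | ⟨-, rfl⟩
      · rw [← pathE_arrow, pathE_mul_pathE (Nat.le_succ j) hab]
        exact pathE_mem_pathSpan ((Nat.le_succ j).trans hab) hb
      · exact absurd h1 (Nat.succ_ne_zero j)
      · obtain rfl := le_antisymm hb hab
        rw [pathE_self, ← h, arE_mul_eV, ← pathE_arrow]
        exact pathE_mem_pathSpan (Nat.le_succ j) hj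
    · rw [← arE_mul_eV, ← eV_mul_pathE, mul_assoc, ← mul_assoc (eV _), eV_mul_eV, if_neg h,
        zero_mul, mul_zero]
      exact zero_mem _
  · rw [mul_zero]
    exact zero_mem _
  · rw [mul_add]
    exact add_mem hx hy
  · rw [mul_smul_comm]
    exact Submodule.smul_mem _ _ hx

lemma mem_pathSpan (hℓ : ∀ i, 1 ≤ ℓ i) (i₀ : Fin t) (x : PathAlg k t ℓ) :
    x ∈ pathSpan k t ℓ := by
  have key (x : Module.End k (PSp k t ℓ)) (hx : x ∈ PathAlg k t ℓ) :
      ∀ y ∈ pathSpan k t ℓ, (⟨x, hx⟩ : PathAlg k t ℓ) * y ∈ pathSpan k t ℓ := by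
    induction hx using Algebra.adjoin_induction with
    | mem x hx =>
      rcases hx with ⟨v, rfl⟩ | ⟨i, j, rfl⟩
      · exact fun y hy => eV_mul_mem_pathSpan v hy
      · exact fun y hy => arE_mul_mem_pathSpan i j hy
    | algebraMap c =>
      intro y hy
      change algebraMap k (PathAlg k t ℓ) c * y ∈ _
      rw [← Algebra.smul_def]
      exact Submodule.smul_mem _ _ hy
    | add x x' hx hx' ih ih' =>
      intro y hy
      change ((⟨x, hx⟩ + ⟨x', hx'⟩ : PathAlg k t ℓ)) * y ∈ _
      rw [add_mul]
      exact add_mem (ih y hy) (ih' y hy)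
    | mul x x' hx hx' ih ih' =>
      intro y hy
      change ((⟨x, hx⟩ * ⟨x', hx'⟩ : PathAlg k t ℓ)) * y ∈ _
      rw [mul_assoc]
      exact ih _ (ih' y hy)
  have h1 : (1 : PathAlg k t ℓ) ∈ pathSpan k t ℓ := by
    rw [← sum_eV]
    refine sum_mem fun v _ => ?_
    obtain ⟨i, a, ha, rfl⟩ := exists_vtx_eq hℓ i₀ v
    rw [← pathE_self]
    exact pathE_mem_pathSpan le_rfl ha
  simpa using key x x.2 1 h1

end PathAlgebra

end Toupie

namespace Toupie

/-! ### The multiplicative basis -/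

section MultiplicativeBasis

variable {k : Type u} [Field k] (T : ToupieAlg k)

lemma mkA_eq_zero_iff {x : PathAlg k T.t T.ℓ} : mkA T x = 0 ↔ x ∈ T.I :=
  (RingCon.eq T.I.ringCon (a := x) (b := 0))

lemma mkA_smul (c : k) (x : PathAlg k T.t T.ℓ) : mkA T (c • x) = c • mkA T x := by
  rw [Algebra.smul_def, Algebra.smul_def, map_mul]
  rfl

/-- The first branch. -/
def firstBranch : Fin T.t := ⟨0, by have := T.ht; omega⟩

variable {T}

lemma mkA_wE_ne_zero (hsc : SimplyConnected T) (i : Fin T.t) : mkA T (wE i) ≠ 0 := by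
  have : Nontrivial (Fin T.t) := Fin.nontrivial_iff_two_le.2 T.ht
  obtain ⟨j, hj⟩ := exists_ne i
  obtain ⟨J, lam, ⟨hJ, -, -, hmin⟩, hi, -⟩ := hsc i j hj.symm
  intro h
  refine hmin {i} ?_ (Finset.singleton_nonempty i) ?_
  · refine (Finset.ssubset_iff_subset_ne).2 ⟨Finset.singleton_subset_iff.2 hi, ?_⟩
    rintro rfl
    simp at hJ
  · rw [Finset.sum_singleton, ← mkA_eq_zero_iff, mkA_smul, h, smul_zero]

lemma lrMap_mkA_wE (i : Fin T.t) : lrMap T (mkA T (wE i)) = mkA T (wE i) := by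
  change mkA T (eV .src) * mkA T (wE i) * mkA T (eV .snk) = mkA T (wE i)
  rw [← map_mul, ← map_mul, wE_eq_pathE (T.hℓ i), ← vtx_zero i, eV_mul_pathE,
    ← vtx_last (T.hℓ i), pathE_mul_eV (Nat.zero_le _)]

lemma exists_mkA_wE_eq_smul (hsc : SimplyConnected T) (hm : mDim T = 1) (i j : Fin T.t) :
    ∃ c : k, c ≠ 0 ∧ mkA T (wE i) = c • mkA T (wE j) := by
  let b (i : Fin T.t) : LinearMap.range (lrMap T) := ⟨mkA T (wE i), _, lrMap_mkA_wE i⟩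
  have hb (i) : b i ≠ 0 := fun h => mkA_wE_ne_zero hsc i (congrArg Subtype.val h)
  obtain ⟨c, hc⟩ := (finrank_eq_one_iff_of_nonzero' (b j) (hb j)).1 hm (b i)
  refine ⟨c, ?_, (congrArg Subtype.val hc).symm⟩
  rintro rfl
  exact hb i (by rw [← hc, zero_smul])

/-- The factor normalizing the paths that start at the `a`-th vertex of branch `i`. -/
def pathScale (c : Fin T.t → k) (i : Fin T.t) (a : ℕ) : k := if a = 0 then (c i)⁻¹ else 1

lemma pathScale_ne_zero {c : Fin T.t → k} (hc : ∀ i, c i ≠ 0) (i : Fin T.t) (a : ℕ) :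
    pathScale c i a ≠ 0 := by
  unfold pathScale
  split_ifs
  · exact inv_ne_zero (hc i)
  · exact one_ne_zero

/-- The normalized path along branch `i` from its `a`-th to its `b`-th vertex. -/
def scaledPath (c : Fin T.t → k) (i : Fin T.t) (a b : ℕ) : Alg T :=
  (pathScale c i a * (pathScale c i b)⁻¹) • mkA T (pathE i a b)

lemma scaledPath_self {c : Fin T.t → k} (hc : ∀ i, c i ≠ 0) (i : Fin T.t) (a : ℕ) :
    scaledPath c i a a = mkA T (eV (vtx T.t T.ℓ i a)) := by
  rw [scaledPath, mul_inv_cancel₀ (pathScale_ne_zero hc i a), one_smul, pathE_self]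

lemma scaledPath_mul {c : Fin T.t → k} (hc : ∀ i, c i ≠ 0) {i : Fin T.t} {a b d : ℕ}
    (hab : a ≤ b) (hbd : b ≤ d) :
    scaledPath c i a b * scaledPath c i b d = scaledPath c i a d := by
  rw [scaledPath, scaledPath, scaledPath, smul_mul_smul_comm, ← map_mul, pathE_mul_pathE hab hbd]
  congr 1
  field_simp [pathScale_ne_zero hc i b]

lemma eV_mul_scaledPath (c : Fin T.t → k) (i : Fin T.t) (a b : ℕ) :
    mkA T (eV (vtx T.t T.ℓ i a)) * scaledPath c i a b = scaledPath c i a b := by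
  rw [scaledPath, mul_smul_comm, ← map_mul, eV_mul_pathE]

lemma scaledPath_mul_eV (c : Fin T.t → k) {i : Fin T.t} {a b : ℕ} (h : a ≤ b) :
    scaledPath c i a b * mkA T (eV (vtx T.t T.ℓ i b)) = scaledPath c i a b := by
  rw [scaledPath, smul_mul_assoc, ← map_mul, pathE_mul_eV h]

lemma scaledPath_branch {c : Fin T.t → k} (hc : ∀ i, c i ≠ 0) {w : Alg T}
    (hw : ∀ i, mkA T (wE i) = c i • w) (i : Fin T.t) : scaledPath c i 0 (T.ℓ i) = w := by
  have := T.hℓ i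
  rw [scaledPath, ← wE_eq_pathE this, hw, pathScale, if_pos rfl, pathScale, if_neg (by omega),
    inv_one, mul_one, inv_smul_smul₀ (hc i)]

lemma scaledPath_congr {c : Fin T.t → k} (hc : ∀ i, c i ≠ 0) {w : Alg T}
    (hw : ∀ i, mkA T (wE i) = c i • w) {i i' : Fin T.t} {a b a' b' : ℕ}
    (hab : a ≤ b) (hb : b ≤ T.ℓ i) (hab' : a' ≤ b') (hb' : b' ≤ T.ℓ i')
    (ha : vtx T.t T.ℓ i a = vtx T.t T.ℓ i' a') (hbb : vtx T.t T.ℓ i b = vtx T.t T.ℓ i' b') :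
    scaledPath c i a b = scaledPath c i' a' b' := by
  by_cases hi : i = i'
  · subst hi
    have := T.hℓ i
    obtain rfl : a = a' := by
      rcases vtx_eq_vtx (hab.trans hb) (hab'.trans hb') ha with h | h | h <;> omega
    obtain rfl : b = b' := by
      rcases vtx_eq_vtx hb hb' hbb with h | h | h <;> omega
    rfl
  rcases (vtx_eq_vtx (hab.trans hb) (hab'.trans hb') ha).resolve_left fun h => hi h.1 with
    ⟨rfl, rfl⟩ | ⟨rfl, rfl⟩
  · rcases (vtx_eq_vtx hb hb' hbb).resolve_left fun h => hi h.1 with ⟨rfl, rfl⟩ | ⟨rfl, rfl⟩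
    · rw [scaledPath_self hc, scaledPath_self hc, ha]
    · rw [scaledPath_branch hc hw, scaledPath_branch hc hw]
  · obtain rfl := le_antisymm hb hab
    obtain rfl := le_antisymm hb' hab'
    rw [scaledPath_self hc, scaledPath_self hc, ha]

/-- The basis element attached to a pair of vertices (zero for unrelated vertices). -/
def basisElt (c : Fin T.t → k) (u v : Vtx T.t T.ℓ) : Alg T :=
  if h : ∃ x : Fin T.t × ℕ × ℕ, x.2.1 ≤ x.2.2 ∧ x.2.2 ≤ T.ℓ x.1 ∧
      u = vtx T.t T.ℓ x.1 x.2.1 ∧ v = vtx T.t T.ℓ x.1 x.2.2 then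
    scaledPath c h.choose.1 h.choose.2.1 h.choose.2.2
  else 0

lemma basisElt_vtx {c : Fin T.t → k} (hc : ∀ i, c i ≠ 0) {w : Alg T}
    (hw : ∀ i, mkA T (wE i) = c i • w) {i : Fin T.t} {a b : ℕ} (hab : a ≤ b) (hb : b ≤ T.ℓ i) :
    basisElt c (vtx T.t T.ℓ i a) (vtx T.t T.ℓ i b) = scaledPath c i a b := by
  have h : ∃ x : Fin T.t × ℕ × ℕ, x.2.1 ≤ x.2.2 ∧ x.2.2 ≤ T.ℓ x.1 ∧
      vtx T.t T.ℓ i a = vtx T.t T.ℓ x.1 x.2.1 ∧ vtx T.t T.ℓ i b = vtx T.t T.ℓ x.1 x.2.2 :=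
    ⟨(i, a, b), hab, hb, rfl, rfl⟩
  rw [basisElt, dif_pos h]
  obtain ⟨h1, h2, h3, h4⟩ := h.choose_spec
  exact (scaledPath_congr hc hw hab hb h1 h2 h3 h4).symm

lemma eV_mul_basisElt (c : Fin T.t → k) (u v : Vtx T.t T.ℓ) :
    mkA T (eV u) * basisElt c u v = basisElt c u v := by
  unfold basisElt
  split_ifs with h
  · have hx := h.choose_spec
    generalize h.choose = x at hx ⊢
    rw [hx.2.2.1, eV_mul_scaledPath]
  · rw [mul_zero]

lemma basisElt_mul_eV (c : Fin T.t → k) (u v : Vtx T.t T.ℓ) :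
    basisElt c u v * mkA T (eV v) = basisElt c u v := by
  unfold basisElt
  split_ifs with h
  · have hx := h.choose_spec
    generalize h.choose = x at hx ⊢
    rw [hx.2.2.2, scaledPath_mul_eV c hx.1]
  · rw [zero_mul]

end MultiplicativeBasis

end Toupie

namespace Toupie

/-- A simply connected toupie algebra with `m = dim_k e₀ A e∞ = 1`
(and `t ≥ 2` branches) is tilted. -/
theorem tilted_of_simplyConnected_of_mDim_one {k : Type u} [Field k] (T : ToupieAlg k)
    (hsc : SimplyConnected T) (hm : mDim T = 1) :
    IsTilted k (Alg T) := by
  let i₀ := firstBranch T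
  choose c hc hw using fun i => exists_mkA_wE_eq_smul hsc hm i i₀
  have hmul (u v w : Vtx T.t T.ℓ) (huv : RotLE u v) (hvw : RotLE v w) :
      basisElt c u v * basisElt c v w = basisElt c u w := by
    obtain ⟨i, a, b, d, hab, hbd, hd, rfl, rfl, rfl⟩ := exists_chain T.hℓ i₀ huv hvw
    rw [basisElt_vtx hc hw hab (hbd.trans hd), basisElt_vtx hc hw hbd hd,
      basisElt_vtx hc hw (hab.trans hbd) hd, scaledPath_mul hc hab hbd]
  refine isTilted_of_multiplicative_basis (basisElt c) hmul ?_ ?_ ?_ ?_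
  · intro u v v' w hv
    rw [← basisElt_mul_eV, ← eV_mul_basisElt c v', mul_assoc, ← mul_assoc (mkA T _), ← map_mul,
      eV_mul_eV, if_neg hv, map_zero, zero_mul, mul_zero]
  · rw [← map_one (mkA T), ← sum_eV, map_sum]
    refine Finset.sum_congr rfl fun v _ => ?_
    obtain ⟨i, a, ha, rfl⟩ := exists_vtx_eq T.hℓ i₀ v
    rw [basisElt_vtx hc hw le_rfl ha, scaledPath_self hc]
  · intro a
    obtain ⟨x, rfl⟩ := mkA_surjective T a
    refine Submodule.span_induction ?_ ?_ (fun x y _ _ hx hy => ?_) (fun c x _ hx => ?_)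
      (mem_pathSpan T.hℓ i₀ x)
    · rintro _ ⟨i, a, b, hab, hb, rfl⟩
      have h0 : pathScale c i a * (pathScale c i b)⁻¹ ≠ 0 :=
        mul_ne_zero (pathScale_ne_zero hc i a) (inv_ne_zero (pathScale_ne_zero hc i b))
      rw [← inv_smul_smul₀ h0 (mkA T (pathE i a b)), ← scaledPath, ← basisElt_vtx hc hw hab hb]
      exact Submodule.smul_mem _ _ (Submodule.subset_span ⟨_, _, rotLE_vtx T.hℓ hab hb, rfl⟩)
    · rw [map_zero]
      exact zero_mem _
    · rw [map_add]
      exact add_mem hx hy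
    · rw [mkA_smul]
      exact Submodule.smul_mem _ _ hx
  · intro u v huv h0
    have hu : RotLE (vtx T.t T.ℓ i₀ 0) u := by
      obtain ⟨i, a, ha, rfl⟩ := exists_vtx_eq T.hℓ i₀ u
      rw [vtx_zero, ← vtx_zero i]
      exact rotLE_vtx T.hℓ (Nat.zero_le a) ha
    have hv : RotLE v (vtx T.t T.ℓ i₀ (T.ℓ i₀)) := Or.inl (vtx_last (T.hℓ i₀))
    have h1 := hmul _ _ _ hu (huv.trans hv)
    rw [← hmul _ _ _ huv hv, h0, zero_mul, mul_zero,
      basisElt_vtx hc hw (Nat.zero_le _) le_rfl, scaledPath_branch hc hw] at h1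
    exact mkA_wE_ne_zero hsc i₀ h1.symm

end Toupie
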